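/- arXiv:1809.00149 — 6 statements merged into one kernel-verified Lean document; each statement's English description precedes it below -/
import Mathlib

section
/- Let T > 0 and let U = (0,T) × (0,∞) × (0,∞) ⊆ ℝ³. Let F : ℝ³ → ℝ be twice continuously differentiable on U. Then F satisfies the system of PDEs ∂²F/∂x₃²(x) = 0 and ∂F/∂x₁(x) + x₃·∂F/∂x₂(x) = 0 at every point x = (x₁,x₂,x₃) of U if and only if there exist constants c₁, c₂, c₃ ∈ ℝ such that F(x₁,x₂,x₃) = c₁(x₁x₃ − x₂) + c₂x₃ + c₃ for all (x₁,x₂,x₃) ∈ U. -/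
open Set

/-- Partial derivative of `F : (Fin n → ℝ) → ℝ` in the `i`-th coordinate direction. -/
noncomputable def pd {n : ℕ} (i : Fin n) (F : (Fin n → ℝ) → ℝ) (x : Fin n → ℝ) : ℝ :=
  fderiv ℝ F x (Pi.single i 1)

lemma lin_of_deriv {S : Set ℝ} (ho : IsOpen S) (hc : IsPreconnected S) {g : ℝ → ℝ} {c : ℝ}
    (h : ∀ x ∈ S, HasDerivAt g c x) {x y : ℝ} (hx : x ∈ S) (hy : y ∈ S) :
    g x = g y + c * (x - y) := by
  have h1 : ∀ z ∈ S, HasDerivAt (fun z => g z - c * z) 0 z := by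
    intro z hz
    have := (h z hz).sub ((hasDerivAt_id z).const_mul c)
    rw [mul_one, sub_self] at this
    exact this
  have := ho.is_const_of_deriv_eq_zero hc
    (fun z hz => (h1 z hz).differentiableAt.differentiableWithinAt)
    (fun z hz => (h1 z hz).deriv) hx hy
  linarith

lemma curried (T : ℝ) (hT : 0 < T) (f ft fa fs : ℝ → ℝ → ℝ → ℝ)
    (h0 : ∀ t ∈ Ioo 0 T, ∀ a ∈ Ioi (0:ℝ), ∀ s ∈ Ioi (0:ℝ),
      HasDerivAt (fun t => f t a s) (ft t a s) t)
    (h1 : ∀ t ∈ Ioo 0 T, ∀ a ∈ Ioi (0:ℝ), ∀ s ∈ Ioi (0:ℝ),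
      HasDerivAt (fun a => f t a s) (fa t a s) a)
    (h2 : ∀ t ∈ Ioo 0 T, ∀ a ∈ Ioi (0:ℝ), ∀ s ∈ Ioi (0:ℝ),
      HasDerivAt (fun s => f t a s) (fs t a s) s)
    (h22 : ∀ t ∈ Ioo 0 T, ∀ a ∈ Ioi (0:ℝ), ∀ s ∈ Ioi (0:ℝ),
      HasDerivAt (fun s => fs t a s) 0 s)
    (hp : ∀ t ∈ Ioo 0 T, ∀ a ∈ Ioi (0:ℝ), ∀ s ∈ Ioi (0:ℝ), ft t a s + s * fa t a s = 0) :
    ∃ c₁ c₂ c₃ : ℝ, ∀ t ∈ Ioo 0 T, ∀ a ∈ Ioi (0:ℝ), ∀ s ∈ Ioi (0:ℝ),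
      f t a s = c₁ * (t * s - a) + c₂ * s + c₃ := by
  have p1 : (1:ℝ) ∈ Ioi (0:ℝ) := by simp
  have p2 : (2:ℝ) ∈ Ioi (0:ℝ) := by simp
  have p3 : (3:ℝ) ∈ Ioi (0:ℝ) := by simp
  have oI : IsOpen (Ioi (0:ℝ)) := isOpen_Ioi
  have cI : IsPreconnected (Ioi (0:ℝ)) := isPreconnected_Ioi
  have oT : IsOpen (Ioo 0 T) := isOpen_Ioo
  have cT : IsPreconnected (Ioo 0 T) := isPreconnected_Ioo
  have ht0 : T / 2 ∈ Ioo 0 T := ⟨by linarith, by linarith⟩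
  generalize T / 2 = t0 at ht0
  have key : ∀ t ∈ Ioo 0 T, ∀ a ∈ Ioi (0:ℝ), ∀ s ∈ Ioi (0:ℝ),
      f t a s = (2 * f t a 1 - f t a 2) + s * (f t a 2 - f t a 1) := by
    intro t ht a ha s hs
    have e : ∀ s ∈ Ioi (0:ℝ), HasDerivAt (fun s => f t a s) (fs t a 1) s := by
      intro s hs
      have := lin_of_deriv oI cI (h22 t ht a ha) hs p1
      rw [show fs t a 1 = fs t a s by linarith]
      exact h2 t ht a ha s hs
    have e1 := lin_of_deriv oI cI e hs p1
    have e2 := lin_of_deriv oI cI e p2 p1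
    rw [e1, e2]; ring
  have keyt : ∀ t ∈ Ioo 0 T, ∀ a ∈ Ioi (0:ℝ), ∀ s ∈ Ioi (0:ℝ),
      ft t a s = (2 * ft t a 1 - ft t a 2) + s * (ft t a 2 - ft t a 1) := by
    intro t ht a ha s hs
    refine (h0 t ht a ha s hs).unique ?_
    refine HasDerivAt.congr_of_eventuallyEq ((((h0 t ht a ha 1 p1).const_mul 2).sub
      (h0 t ht a ha 2 p2)).add
      (((h0 t ht a ha 2 p2).sub (h0 t ht a ha 1 p1)).const_mul s)) ?_
    filter_upwards [oT.mem_nhds ht] with t ht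
    exact key t ht a ha s hs
  have keya : ∀ t ∈ Ioo 0 T, ∀ a ∈ Ioi (0:ℝ), ∀ s ∈ Ioi (0:ℝ),
      fa t a s = (2 * fa t a 1 - fa t a 2) + s * (fa t a 2 - fa t a 1) := by
    intro t ht a ha s hs
    refine (h1 t ht a ha s hs).unique ?_
    refine HasDerivAt.congr_of_eventuallyEq ((((h1 t ht a ha 1 p1).const_mul 2).sub
      (h1 t ht a ha 2 p2)).add
      (((h1 t ht a ha 2 p2).sub (h1 t ht a ha 1 p1)).const_mul s)) ?_
    filter_upwards [oI.mem_nhds ha] with a ha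
    exact key t ht a ha s hs
  -- the three coefficient identities
  have alg : ∀ t ∈ Ioo 0 T, ∀ a ∈ Ioi (0:ℝ), 2 * ft t a 1 - ft t a 2 = 0 ∧
      fa t a 2 - fa t a 1 = 0 ∧ ft t a 2 - ft t a 1 = -(2 * fa t a 1 - fa t a 2) := by
    intro t ht a ha
    have q1 := hp t ht a ha 1 p1
    have q2 := hp t ht a ha 2 p2
    have q3 := hp t ht a ha 3 p3
    have r3 := keyt t ht a ha 3 p3
    have r3' := keya t ht a ha 3 p3
    refine ⟨?_, ?_, ?_⟩ <;> linarith
  have dAt : ∀ a ∈ Ioi (0:ℝ), ∀ t ∈ Ioo 0 T,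
      HasDerivAt (fun t => 2 * f t a 1 - f t a 2) 0 t := by
    intro a ha t ht
    rw [← (alg t ht a ha).1]
    exact ((h0 t ht a ha 1 p1).const_mul 2).sub (h0 t ht a ha 2 p2)
  have dBa : ∀ t ∈ Ioo 0 T, ∀ a ∈ Ioi (0:ℝ),
      HasDerivAt (fun a => f t a 2 - f t a 1) 0 a := by
    intro t ht a ha
    rw [← (alg t ht a ha).2.1]
    exact (h1 t ht a ha 2 p2).sub (h1 t ht a ha 1 p1)
  have cA : ∀ t ∈ Ioo 0 T, ∀ a ∈ Ioi (0:ℝ),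
      2 * f t a 1 - f t a 2 = 2 * f t0 a 1 - f t0 a 2 := by
    intro t ht a ha
    have := lin_of_deriv oT cT (dAt a ha) ht ht0
    linarith
  have cB : ∀ t ∈ Ioo 0 T, ∀ a ∈ Ioi (0:ℝ),
      f t a 2 - f t a 1 = f t 1 2 - f t 1 1 := by
    intro t ht a ha
    have := lin_of_deriv oI cI (dBa t ht) ha p1
    linarith
  have dB : ∀ t ∈ Ioo 0 T, ∀ a ∈ Ioi (0:ℝ),
      HasDerivAt (fun t => f t 1 2 - f t 1 1) (ft t a 2 - ft t a 1) t := by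
    intro t ht a ha
    refine ((h0 t ht a ha 2 p2).sub (h0 t ht a ha 1 p1)).congr_of_eventuallyEq ?_
    filter_upwards [oT.mem_nhds ht] with t ht
    exact (cB t ht a ha).symm
  have dA : ∀ t ∈ Ioo 0 T, ∀ a ∈ Ioi (0:ℝ),
      HasDerivAt (fun a => 2 * f t0 a 1 - f t0 a 2) (2 * fa t a 1 - fa t a 2) a := by
    intro t ht a ha
    refine (((h1 t ht a ha 1 p1).const_mul 2).sub (h1 t ht a ha 2 p2)).congr_of_eventuallyEq ?_
    filter_upwards [oI.mem_nhds ha] with a ha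
    exact (cA t ht a ha).symm
  obtain ⟨c, hc⟩ : ∃ c, c = ft t0 1 2 - ft t0 1 1 := ⟨_, rfl⟩
  have eA : ∀ a ∈ Ioi (0:ℝ), HasDerivAt (fun a => 2 * f t0 a 1 - f t0 a 2) (-c) a := by
    intro a ha
    have := dA t0 ht0 a ha
    have u := (dB t0 ht0 a ha).unique (dB t0 ht0 1 p1)
    have v := (alg t0 ht0 a ha).2.2
    rwa [show -c = 2 * fa t0 a 1 - fa t0 a 2 by linarith]
  have eB : ∀ t ∈ Ioo 0 T, HasDerivAt (fun t => f t 1 2 - f t 1 1) c t := by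
    intro t ht
    have := dB t ht 1 p1
    have u := (dA t ht 1 p1).unique (eA 1 p1)
    have v := (alg t ht 1 p1).2.2
    rwa [show c = ft t 1 2 - ft t 1 1 by linarith]
  refine ⟨c, (f t0 1 2 - f t0 1 1) - c * t0, (2 * f t0 1 1 - f t0 1 2) + c, ?_⟩
  intro t ht a ha s hs
  have x1 := lin_of_deriv oI cI eA ha p1
  have x2 := lin_of_deriv oT cT eB ht ht0
  rw [key t ht a ha s hs, cA t ht a ha, cB t ht a ha, x1, x2]
  ring

lemma pd_hasDerivAt {n : ℕ} (i : Fin n) (G : (Fin n → ℝ) → ℝ) (p : ℝ → Fin n → ℝ) (u : ℝ)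
    (hG : DifferentiableAt ℝ G (p u)) (hp : p = fun v => Function.update (p u) i v) :
    HasDerivAt (fun v => G (p v)) (pd i G (p u)) u := by
  have h : HasDerivAt p (Pi.single i 1) u := by
    have := hasDerivAt_update (𝕜 := ℝ) (p u) i u
    rw [hp]
    exact this
  exact hG.hasFDerivAt.comp_hasDerivAt u h

/-- Characterisation of `C²` solutions on `U = (0,T) × (0,∞) × (0,∞)` of the system
`∂²F/∂x₃² = 0` and `∂F/∂x₁ + x₃ ∂F/∂x₂ = 0`. -/
theorem statement0 (T : ℝ) (hT : 0 < T)
    (U : Set (Fin 3 → ℝ))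
    (hU : U = {x | x 0 ∈ Ioo (0:ℝ) T ∧ x 1 ∈ Ioi (0:ℝ) ∧ x 2 ∈ Ioi (0:ℝ)})
    (F : (Fin 3 → ℝ) → ℝ) (hF : ContDiffOn ℝ 2 F U) :
    (∀ x ∈ U, pd 2 (pd 2 F) x = 0 ∧ pd 0 F x + x 2 * pd 1 F x = 0) ↔
      ∃ c₁ c₂ c₃ : ℝ, ∀ x ∈ U,
        F x = c₁ * (x 0 * x 2 - x 1) + c₂ * x 2 + c₃ := by
  have hUo : IsOpen U := by
    rw [hU]
    exact (isOpen_Ioo.preimage (continuous_apply 0)).inter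
      ((isOpen_Ioi.preimage (continuous_apply 1)).inter
        (isOpen_Ioi.preimage (continuous_apply 2)))
  constructor
  · intro h
    have hd : ∀ x ∈ U, DifferentiableAt ℝ F x := fun x hx =>
      (hF.differentiableOn (by norm_num)).differentiableAt (hUo.mem_nhds hx)
    have hd2 : ∀ x ∈ U, DifferentiableAt ℝ (pd 2 F) x := by
      intro x hx
      have := (hF.fderiv_of_isOpen hUo (m := 1) (by norm_num)).differentiableOn (by norm_num)
      exact (this.differentiableAt (hUo.mem_nhds hx)).clm_apply (differentiableAt_const _)
    have mem : ∀ t ∈ Ioo 0 T, ∀ a ∈ Ioi (0:ℝ), ∀ s ∈ Ioi (0:ℝ), ![t, a, s] ∈ U := by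
      intro t ht a ha s hs
      rw [hU]
      exact ⟨ht, ha, hs⟩
    obtain ⟨c₁, c₂, c₃, H⟩ := curried T hT (fun t a s => F ![t, a, s])
      (fun t a s => pd 0 F ![t, a, s]) (fun t a s => pd 1 F ![t, a, s])
      (fun t a s => pd 2 F ![t, a, s])
      (fun t ht a ha s hs => pd_hasDerivAt 0 F (fun t => ![t, a, s]) t
        (hd _ (mem t ht a ha s hs)) (by ext v j; fin_cases j <;> simp))
      (fun t ht a ha s hs => pd_hasDerivAt 1 F (fun a => ![t, a, s]) a
        (hd _ (mem t ht a ha s hs)) (by ext v j; fin_cases j <;> simp))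
      (fun t ht a ha s hs => pd_hasDerivAt 2 F (fun s => ![t, a, s]) s
        (hd _ (mem t ht a ha s hs)) (by ext v j; fin_cases j <;> simp))
      (fun t ht a ha s hs => by
        have := pd_hasDerivAt 2 (pd 2 F) (fun s => ![t, a, s]) s
          (hd2 _ (mem t ht a ha s hs)) (by ext v j; fin_cases j <;> simp)
        rwa [(h _ (mem t ht a ha s hs)).1] at this)
      (fun t ht a ha s hs => (h _ (mem t ht a ha s hs)).2)
    refine ⟨c₁, c₂, c₃, fun x hx => ?_⟩
    rw [hU] at hx
    have := H (x 0) hx.1 (x 1) hx.2.1 (x 2) hx.2.2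
    rw [← this]
    congr 1
    ext j; fin_cases j <;> rfl
  · rintro ⟨c₁, c₂, c₃, H⟩
    have pr : ∀ (i : Fin 3) (x : Fin 3 → ℝ), HasFDerivAt (fun y : Fin 3 → ℝ => y i)
      (ContinuousLinearMap.proj (R := ℝ) (φ := fun _ : Fin 3 => ℝ) i) x :=
      fun i x => hasFDerivAt_apply i x
    have hfd : ∀ x ∈ U, ∀ i, pd i F x = c₁ * (x 0 * (Pi.single i 1 : Fin 3 → ℝ) 2 +
        x 2 * (Pi.single i 1 : Fin 3 → ℝ) 0 - (Pi.single i 1 : Fin 3 → ℝ) 1)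
        + c₂ * (Pi.single i 1 : Fin 3 → ℝ) 2 := by
      intro x hx i
      have e : HasFDerivAt F _ x :=
        HasFDerivAt.congr_of_eventuallyEq
          ((((((pr 0 x).mul (pr 2 x)).sub (pr 1 x)).const_mul c₁).add
            ((pr 2 x).const_mul c₂)).add_const c₃)
          (by filter_upwards [hUo.mem_nhds hx] with y hy using H y hy)
      rw [pd, e.fderiv]
      simp
    intro x hx
    constructor
    · have e : HasFDerivAt (pd 2 F) _ x :=
        HasFDerivAt.congr_of_eventuallyEq (((pr 0 x).const_mul c₁).add_const c₂)
          (by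
            filter_upwards [hUo.mem_nhds hx] with y hy
            rw [hfd y hy]
            simp)
      rw [pd, e.fderiv]
      simp
    · rw [hfd x hx, hfd x hx]
      simp
      ring
end

section
/- Let U = (0,∞)³ with coordinates (s,v,q). Let g : (0,∞) → ℝ be twice continuously differentiable and let w : (0,∞) → (0,∞) be continuous. Let F : U → ℝ be twice continuously differentiable. Then F satisfies the system of PDEs w(s)·∂F/∂q − (1/2)·g''(s)·∂F/∂v + (1/2)·∂²F/∂s² = 0, ∂²F/∂v² = 0, and ∂²F/∂s∂v = 0 at every point of U, if and only if there exist a constant c ∈ ℝ and a twice continuously differentiable function F_h : (0,∞)² → ℝ satisfying the weighted heat equation 2·w(s)·∂F_h/∂q(s,q) + ∂²F_h/∂s²(s,q) = 0 on (0,∞)², such that F(s,v,q) = c·(v + g(s)) + F_h(s,q) for all (s,v,q) ∈ U. -/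
open Set

open Topology Filter

lemma aux_pd_contDiff {n : ℕ} {U : Set (Fin n → ℝ)} (hU : IsOpen U) {F : (Fin n → ℝ) → ℝ}
    (hF : ContDiffOn ℝ 2 F U) (i : Fin n) : ContDiffOn ℝ 1 (pd i F) U := by
  have h := hF.fderiv_of_isOpen (m := 1) hU (by norm_num)
  exact h.clm_apply contDiffOn_const

lemma aux_pd_diff {n : ℕ} {U : Set (Fin n → ℝ)} (hU : IsOpen U) {F : (Fin n → ℝ) → ℝ}
    (hF : ContDiffOn ℝ 2 F U) (i : Fin n) {x : Fin n → ℝ} (hx : x ∈ U) :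
    DifferentiableAt ℝ (pd i F) x :=
  ((aux_pd_contDiff hU hF i).differentiableOn (by norm_num)).differentiableAt (hU.mem_nhds hx)

lemma aux_pd_comm {n : ℕ} {U : Set (Fin n → ℝ)} (hU : IsOpen U) {F : (Fin n → ℝ) → ℝ}
    (hF : ContDiffOn ℝ 2 F U) (i j : Fin n) {x : Fin n → ℝ} (hx : x ∈ U) :
    pd i (pd j F) x = pd j (pd i F) x := by
  have hc : ContDiffAt ℝ 2 F x := hF.contDiffAt (hU.mem_nhds hx)
  have hs : IsSymmSndFDerivAt ℝ F x := hc.isSymmSndFDerivAt (by simp)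
  have hd : DifferentiableAt ℝ (fderiv ℝ F) x :=
    ((hF.fderiv_of_isOpen (m := 1) hU (by norm_num)).differentiableOn
      (by norm_num)).differentiableAt (hU.mem_nhds hx)
  have key : ∀ a b : Fin n, pd a (pd b F) x
      = fderiv ℝ (fderiv ℝ F) x (Pi.single a 1) (Pi.single b 1) := by
    intro a b
    have := (hd.hasFDerivAt.clm_apply (hasFDerivAt_const (Pi.single b (1:ℝ)) x)).fderiv
    unfold pd
    rw [this]
    simp
  rw [key, key]
  exact hs _ _

/-- constancy along a coordinate line -/
lemma aux_line {n : ℕ} {U : Set (Fin n → ℝ)} (hU : IsOpen U) (hconv : Convex ℝ U)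
    {G : (Fin n → ℝ) → ℝ} (i : Fin n) (hG : DifferentiableOn ℝ G U)
    (h0 : ∀ x ∈ U, pd i G x = 0) (x : Fin n → ℝ) (t : ℝ) (hx : x ∈ U)
    (hxt : x + t • Pi.single i (1:ℝ) ∈ U) : G (x + t • Pi.single i (1:ℝ)) = G x := by
  set e : Fin n → ℝ := t • Pi.single i (1:ℝ) with he
  have hmem : ∀ r ∈ Icc (0:ℝ) 1, x + r • e ∈ U := by
    intro r hr
    have := hconv.add_smul_mem hx hxt hr
    exact this
  have hd : ∀ r ∈ Icc (0:ℝ) 1, HasDerivAt (fun r : ℝ => G (x + r • e)) 0 r := by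
    intro r hr
    have h1 := (hG.differentiableAt (hU.mem_nhds (hmem r hr))).hasFDerivAt
    have h2 : HasDerivAt (fun r : ℝ => x + r • e) e r := by
      simpa using ((hasDerivAt_id r).smul_const e).const_add x
    have h3 := h1.comp_hasDerivAt r h2
    have h4 : fderiv ℝ G (x + r • e) e = 0 := by
      have := h0 _ (hmem r hr)
      unfold pd at this
      conv_lhs => rw [he]
      rw [map_smul, this, smul_zero]
    rw [h4] at h3
    exact h3
  have := constant_of_has_deriv_right_zero (f := fun r : ℝ => G (x + r • e)) (a := 0) (b := 1)
    (fun r hr => (hd r hr).continuousAt.continuousWithinAt)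
    (fun r hr => (hd r ⟨hr.1, hr.2.le⟩).hasDerivWithinAt) 1 (by simp)
  simpa using this

lemma aux_repr (G : (Fin 3 → ℝ) → ℝ) (H : (Fin 2 → ℝ) → ℝ) (k : ℝ → ℝ) (c d : ℝ)
    (x : Fin 3 → ℝ) (hk : DifferentiableAt ℝ k (x 0)) (hH : DifferentiableAt ℝ H ![x 0, x 2])
    (h : G =ᶠ[𝓝 x] fun y => c * k (y 0) + d * y 1 + H ![y 0, y 2]) :
    pd 0 G x = c * deriv k (x 0) + pd 0 H ![x 0, x 2] ∧ pd 1 G x = d ∧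
      pd 2 G x = pd 1 H ![x 0, x 2] := by
  let p : (Fin 3 → ℝ) →L[ℝ] (Fin 2 → ℝ) :=
    ContinuousLinearMap.pi ![ContinuousLinearMap.proj 0, ContinuousLinearMap.proj 2]
  have hp : ∀ y : Fin 3 → ℝ, p y = ![y 0, y 2] := by
    intro y; ext j; fin_cases j <;> simp [p]
  have h0 : HasFDerivAt (fun y : Fin 3 → ℝ => y 0)
      (ContinuousLinearMap.proj 0 : (Fin 3 → ℝ) →L[ℝ] ℝ) x :=
    (ContinuousLinearMap.proj (R := ℝ) (φ := fun _ : Fin 3 => ℝ) 0).hasFDerivAt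
  have h1 : HasFDerivAt (fun y : Fin 3 → ℝ => y 1)
      (ContinuousLinearMap.proj 1 : (Fin 3 → ℝ) →L[ℝ] ℝ) x :=
    (ContinuousLinearMap.proj (R := ℝ) (φ := fun _ : Fin 3 => ℝ) 1).hasFDerivAt
  have hkk := (hk.hasDerivAt.comp_hasFDerivAt x h0).const_mul c
  have hHH : HasFDerivAt (fun y : Fin 3 → ℝ => H ![y 0, y 2])
      ((fderiv ℝ H ![x 0, x 2]).comp p) x := by
    have a1 : HasFDerivAt H (fderiv ℝ H ![x 0, x 2]) (p x) := by
      rw [hp]; exact hH.hasFDerivAt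
    have a2 := a1.comp x p.hasFDerivAt
    have a3 : (H ∘ p) = fun y : Fin 3 → ℝ => H ![y 0, y 2] := by
      funext y; simp only [Function.comp, hp]
    rw [a3] at a2
    exact a2
  have hall := ((hkk.add (h1.const_mul d)).add hHH).congr_of_eventuallyEq h
  have e0 : (![1, 0] : Fin 2 → ℝ) = Pi.single 0 1 := by ext j; fin_cases j <;> simp
  have e1 : (![0, 1] : Fin 2 → ℝ) = Pi.single 1 1 := by ext j; fin_cases j <;> simp
  have e2 : (![0, 0] : Fin 2 → ℝ) = 0 := by ext j; fin_cases j <;> simp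
  unfold pd
  rw [hall.fderiv]
  refine ⟨?_, ?_, ?_⟩ <;> simp [hp, e0, e1, e2]

lemma aux_all (g : ℝ → ℝ) (hg : ContDiffOn ℝ 2 g (Ioi 0))
    (U : Set (Fin 3 → ℝ)) (hU : U = {x | 0 < x 0 ∧ 0 < x 1 ∧ 0 < x 2}) (hUo : IsOpen U)
    (F : (Fin 3 → ℝ) → ℝ) (c : ℝ) (Fh : (Fin 2 → ℝ) → ℝ)
    (hFh : ContDiffOn ℝ 2 Fh {y | 0 < y 0 ∧ 0 < y 1})
    (hrep : ∀ x ∈ U, F x = c * (x 1 + g (x 0)) + Fh ![x 0, x 2]) (x : Fin 3 → ℝ) (hx : x ∈ U) :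
    pd 2 F x = pd 1 Fh ![x 0, x 2] ∧ pd 1 F x = c ∧
    pd 0 (pd 0 F) x = c * deriv (deriv g) (x 0) + pd 0 (pd 0 Fh) ![x 0, x 2] ∧
    pd 1 (pd 1 F) x = 0 ∧ pd 0 (pd 1 F) x = 0 := by
  have hVo : IsOpen {y : Fin 2 → ℝ | 0 < y 0 ∧ 0 < y 1} :=
    (isOpen_lt continuous_const (continuous_apply 0)).inter
      (isOpen_lt continuous_const (continuous_apply 1))
  have hV : ∀ y ∈ U, (![y 0, y 2] : Fin 2 → ℝ) ∈ {y : Fin 2 → ℝ | 0 < y 0 ∧ 0 < y 1} := by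
    intro y hy; rw [hU] at hy; exact ⟨hy.1, hy.2.2⟩
  have h0 : ∀ y ∈ U, 0 < y 0 := by intro y hy; rw [hU] at hy; exact hy.1
  have hA : ∀ y ∈ U, pd 0 F y = c * deriv g (y 0) + pd 0 Fh ![y 0, y 2] ∧ pd 1 F y = c ∧
      pd 2 F y = pd 1 Fh ![y 0, y 2] := by
    intro y hy
    refine aux_repr F Fh g c c y ?_ ?_ ?_
    · exact (hg.differentiableOn (by norm_num)).differentiableAt (Ioi_mem_nhds (h0 y hy))
    · exact (hFh.differentiableOn (by norm_num)).differentiableAt (hVo.mem_nhds (hV y hy))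
    · filter_upwards [hUo.mem_nhds hy] with z hz
      rw [hrep z hz]; ring
  have hg' : DifferentiableAt ℝ (deriv g) (x 0) :=
    ((hg.deriv_of_isOpen (m := 1) isOpen_Ioi (by norm_num)).differentiableOn
      (by norm_num)).differentiableAt (Ioi_mem_nhds (h0 x hx))
  have hB := aux_repr (pd 0 F) (pd 0 Fh) (deriv g) c 0 x hg'
    (aux_pd_diff hVo hFh 0 (hV x hx)) (by
      filter_upwards [hUo.mem_nhds hx] with z hz
      rw [(hA z hz).1]; ring)
  have hC : pd 1 F =ᶠ[𝓝 x] fun _ => c := by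
    filter_upwards [hUo.mem_nhds hx] with z hz
    exact (hA z hz).2.1
  have hD : fderiv ℝ (pd 1 F) x = 0 := by rw [hC.fderiv_eq]; simp
  refine ⟨(hA x hx).2.2, (hA x hx).2.1, hB.1, ?_, ?_⟩ <;>
  · change fderiv ℝ (pd 1 F) x _ = 0
    rw [hD]; rfl

/-- Characterisation of `C²` solutions on `U = (0,∞)³` (coordinates `(s,v,q) = (x 0, x 1, x 2)`)
of the system `w(s) ∂F/∂q - (1/2) g''(s) ∂F/∂v + (1/2) ∂²F/∂s² = 0`, `∂²F/∂v² = 0`,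
`∂²F/∂s∂v = 0`: exactly the functions `c (v + g s) + F_h (s, q)` with `F_h` a solution of the
weighted heat equation `2 w(s) ∂F_h/∂q + ∂²F_h/∂s² = 0`. -/
theorem statement1 (g w : ℝ → ℝ)
    (hg : ContDiffOn ℝ 2 g (Ioi 0))
    (hw : ContinuousOn w (Ioi 0)) (hwpos : ∀ s ∈ Ioi (0:ℝ), 0 < w s)
    (U : Set (Fin 3 → ℝ)) (hU : U = {x | 0 < x 0 ∧ 0 < x 1 ∧ 0 < x 2})
    (F : (Fin 3 → ℝ) → ℝ) (hF : ContDiffOn ℝ 2 F U) :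
    (∀ x ∈ U,
        w (x 0) * pd 2 F x - (1/2) * deriv (deriv g) (x 0) * pd 1 F x
            + (1/2) * pd 0 (pd 0 F) x = 0 ∧
        pd 1 (pd 1 F) x = 0 ∧
        pd 0 (pd 1 F) x = 0) ↔
      ∃ (c : ℝ) (Fh : (Fin 2 → ℝ) → ℝ),
        ContDiffOn ℝ 2 Fh {y | 0 < y 0 ∧ 0 < y 1} ∧
        (∀ y : Fin 2 → ℝ, 0 < y 0 → 0 < y 1 →
            2 * w (y 0) * pd 1 Fh y + pd 0 (pd 0 Fh) y = 0) ∧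
        (∀ x ∈ U, F x = c * (x 1 + g (x 0)) + Fh ![x 0, x 2]) := by
  have hUo : IsOpen U := by
    rw [hU]
    exact (isOpen_lt continuous_const (continuous_apply 0)).inter
      ((isOpen_lt continuous_const (continuous_apply 1)).inter
        (isOpen_lt continuous_const (continuous_apply 2)))
  have hUc : Convex ℝ U := by
    rw [hU]
    intro x hx y hy a b ha hb hab
    have key : ∀ i : Fin 3, 0 < x i → 0 < y i → 0 < (a • x + b • y) i := by
      intro i h1 h2
      exact (convex_Ioi (0:ℝ)) h1 h2 ha hb hab
    exact ⟨key 0 hx.1 hy.1, key 1 hx.2.1 hy.2.1, key 2 hx.2.2 hy.2.2⟩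
  constructor
  · intro h
    have hpdd : ∀ i, DifferentiableOn ℝ (pd i F) U := fun i x hx =>
      (aux_pd_diff hUo hF i hx).differentiableWithinAt
    have hmov : ∀ x ∈ U, ∀ t : ℝ, x + t • Pi.single (1 : Fin 3) (1:ℝ) ∈ U →
        pd 2 F (x + t • Pi.single (1 : Fin 3) (1:ℝ)) = pd 2 F x := by
      intro x hx t hxt
      have hv : pd 1 F (x + t • Pi.single (1 : Fin 3) (1:ℝ)) = pd 1 F x :=
        aux_line hUo hUc 1 (hpdd 1) (fun y hy => (h y hy).2.1) x t hx hxt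
      have hs : ∀ y ∈ U, y + t • Pi.single (1 : Fin 3) (1:ℝ) ∈ U →
          pd 0 F (y + t • Pi.single (1 : Fin 3) (1:ℝ)) = pd 0 F y := fun y hy hyt =>
        aux_line hUo hUc 1 (hpdd 0)
          (fun z hz => by rw [aux_pd_comm hUo hF 1 0 hz]; exact (h z hz).2.2) y t hy hyt
      have hss : pd 0 (pd 0 F) (x + t • Pi.single (1 : Fin 3) (1:ℝ)) = pd 0 (pd 0 F) x := by
        have hcont : ContinuousAt (fun y : Fin 3 → ℝ => y + t • Pi.single (1 : Fin 3) (1:ℝ)) x := by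
          fun_prop
        have hev : (fun y => pd 0 F (y + t • Pi.single (1 : Fin 3) (1:ℝ))) =ᶠ[𝓝 x] pd 0 F := by
          filter_upwards [hUo.mem_nhds hx, hcont (hUo.mem_nhds hxt)] with y hy hyt
          exact hs y hy hyt
        have := hev.fderiv_eq (𝕜 := ℝ)
        rw [fderiv_comp_add_right] at this
        change fderiv ℝ (pd 0 F) _ _ = fderiv ℝ (pd 0 F) _ _
        rw [this]
      have e1 := (h x hx).1
      have e2 := (h _ hxt).1
      have h00 : (x + t • Pi.single (1 : Fin 3) (1:ℝ) : Fin 3 → ℝ) 0 = x 0 := by simp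
      rw [hv, hss, h00] at e2
      have hx0 : 0 < w (x 0) := hwpos _ (by rw [hU] at hx; exact hx.1)
      apply mul_left_cancel₀ hx0.ne'
      linarith
    have h12 : ∀ x ∈ U, pd 1 (pd 2 F) x = 0 := by
      intro x hx
      have hline : HasDerivAt (fun r : ℝ => x + r • Pi.single (1 : Fin 3) (1:ℝ))
          (Pi.single (1 : Fin 3) (1:ℝ)) 0 := by
        simpa using ((hasDerivAt_id (0:ℝ)).smul_const (Pi.single (1 : Fin 3) (1:ℝ))).const_add x
      have hd : HasFDerivAt (pd 2 F) (fderiv ℝ (pd 2 F) x)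
          (x + (0:ℝ) • Pi.single (1 : Fin 3) (1:ℝ)) := by
        simpa using (aux_pd_diff hUo hF 2 hx).hasFDerivAt
      have h3 := hd.comp_hasDerivAt (0:ℝ) hline
      have hev : (pd 2 F ∘ fun r : ℝ => x + r • Pi.single (1 : Fin 3) (1:ℝ)) =ᶠ[𝓝 0]
          fun _ => pd 2 F x := by
        have : ∀ᶠ r in 𝓝 (0:ℝ), x + r • Pi.single (1 : Fin 3) (1:ℝ) ∈ U :=
          hline.continuousAt.eventually_mem (hUo.mem_nhds (by simpa using hx))
        filter_upwards [this] with r hr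
        exact hmov x hx r hr
      exact h3.unique ((hasDerivAt_const (0:ℝ) (pd 2 F x)).congr_of_eventuallyEq hev)
    have hfd : ∀ x ∈ U, fderiv ℝ (pd 1 F) x = 0 := by
      intro x hx
      apply ContinuousLinearMap.coe_injective
      apply LinearMap.pi_ext'
      intro i
      ext
      fin_cases i
      · simpa [pd] using (h x hx).2.2
      · simpa [pd] using (h x hx).2.1
      · have := aux_pd_comm hUo hF 2 1 hx
        rw [h12 x hx] at this
        simpa [pd] using this
    have h1U : (fun _ => 1 : Fin 3 → ℝ) ∈ U := by rw [hU]; simp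
    obtain ⟨c, hc⟩ : ∃ c, ∀ x ∈ U, pd 1 F x = c :=
      ⟨pd 1 F (fun _ => 1), fun x hx =>
        (hUc.is_const_of_fderivWithin_eq_zero (𝕜 := ℝ) (hpdd 1)
          (fun y hy => by rw [fderivWithin_of_isOpen hUo hy]; exact hfd y hy) hx h1U)⟩
    have hFd : ∀ x ∈ U, DifferentiableAt ℝ F x := fun x hx =>
      (hF.differentiableOn (by norm_num)).differentiableAt (hUo.mem_nhds hx)
    have hproj : ∀ x, HasFDerivAt (fun y : Fin 3 → ℝ => y 1)
        (ContinuousLinearMap.proj 1 : (Fin 3 → ℝ) →L[ℝ] ℝ) x := fun x =>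
      (ContinuousLinearMap.proj (R := ℝ) (φ := fun _ : Fin 3 => ℝ) 1).hasFDerivAt
    have hGd : ∀ x ∈ U, HasFDerivAt (fun y : Fin 3 → ℝ => F y - c * y 1)
        (fderiv ℝ F x - c • (ContinuousLinearMap.proj 1 : (Fin 3 → ℝ) →L[ℝ] ℝ)) x :=
      fun x hx => (hFd x hx).hasFDerivAt.sub ((hproj x).const_mul c)
    have hG0 : ∀ x ∈ U, pd 1 (fun y : Fin 3 → ℝ => F y - c * y 1) x = 0 := by
      intro x hx
      have := hc x hx
      unfold pd at this ⊢
      rw [(hGd x hx).fderiv]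
      simp [this]
    have hFh : ContDiffOn ℝ 2 (fun y : Fin 2 → ℝ => F ![y 0, 1, y 1] - c - c * g (y 0))
        {y | 0 < y 0 ∧ 0 < y 1} := by
      have a1 : ContDiff ℝ 2 (fun y : Fin 2 → ℝ => (![y 0, 1, y 1] : Fin 3 → ℝ)) := by
        rw [contDiff_pi]
        intro i
        fin_cases i
        · exact contDiff_apply ℝ ℝ (0 : Fin 2)
        · exact contDiff_const
        · exact contDiff_apply ℝ ℝ (1 : Fin 2)
      have a2 : ContDiffOn ℝ 2 (fun y : Fin 2 → ℝ => F ![y 0, 1, y 1]) {y | 0 < y 0 ∧ 0 < y 1} :=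
        hF.comp a1.contDiffOn (by
          intro y hy; rw [hU]; exact ⟨hy.1, one_pos, hy.2⟩)
      have a3 : ContDiffOn ℝ 2 (fun y : Fin 2 → ℝ => g (y 0)) {y | 0 < y 0 ∧ 0 < y 1} :=
        hg.comp (contDiff_apply ℝ ℝ (0 : Fin 2)).contDiffOn (fun y hy => hy.1)
      exact (a2.sub contDiffOn_const).sub (contDiffOn_const.mul a3)
    have hrep : ∀ x ∈ U, F x = c * (x 1 + g (x 0)) +
        (fun y : Fin 2 → ℝ => F ![y 0, 1, y 1] - c - c * g (y 0)) ![x 0, x 2] := by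
      intro x hx
      have hxe : x + (1 - x 1) • Pi.single (1 : Fin 3) (1:ℝ) = ![x 0, 1, x 2] := by
        ext i; fin_cases i <;> simp
      have hxt : x + (1 - x 1) • Pi.single (1 : Fin 3) (1:ℝ) ∈ U := by
        rw [hxe, hU]; rw [hU] at hx; exact ⟨hx.1, one_pos, hx.2.2⟩
      have := aux_line hUo hUc 1
        (fun y hy => (hGd y hy).differentiableAt.differentiableWithinAt) hG0 x (1 - x 1) hx hxt
      rw [hxe] at this
      simp at this ⊢
      linarith
    refine ⟨c, _, hFh, ?_, hrep⟩
    intro y hy0 hy1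
    have hx : (![y 0, 1, y 1] : Fin 3 → ℝ) ∈ U := by rw [hU]; exact ⟨hy0, one_pos, hy1⟩
    obtain ⟨b1, b2, b3, -, -⟩ := aux_all g hg U hU hUo F c _ hFh hrep _ hx
    have hyy : (![(![y 0, 1, y 1] : Fin 3 → ℝ) 0, (![y 0, 1, y 1] : Fin 3 → ℝ) 2] : Fin 2 → ℝ)
        = y := by ext i; fin_cases i <;> rfl
    have e := (h _ hx).1
    rw [b1, b2, b3, hyy] at e
    have h00 : (![y 0, 1, y 1] : Fin 3 → ℝ) 0 = y 0 := rfl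
    rw [h00] at e
    linarith
  · rintro ⟨c, Fh, hFh, hheat, hrep⟩ x hx
    obtain ⟨b1, b2, b3, b4, b5⟩ := aux_all g hg U hU hUo F c Fh hFh hrep x hx
    refine ⟨?_, b4, b5⟩
    have hx' := hx
    rw [hU] at hx'
    have e := hheat ![x 0, x 2] hx'.1 hx'.2.2
    have h00 : (![x 0, x 2] : Fin 2 → ℝ) 0 = x 0 := rfl
    rw [h00] at e
    rw [b1, b2, b3]
    linarith
end

section
/- Let U = (0,∞)³ with coordinates (s,v,q). Let g : (0,∞) → ℝ be twice continuously differentiable with g''(s) > 0 for all s > 0, and let w : (0,∞) → (0,∞) be continuous. Let F : U → ℝ be twice continuously differentiable. Then F satisfies the system of PDEs g''(s)·∂F/∂v − ∂²F/∂s² = 0, w(s)·∂F/∂q + (1/2)·∂²F/∂v² = 0, and ∂²F/∂s∂v = 0 at every point of U, if and only if there exist constants c₁, c₂, c₃ ∈ ℝ such that F(s,v,q) = c₁·(g(s) + v) + c₂·s + c₃ for all (s,v,q) ∈ U. -/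
open Set

open Filter Topology

lemma pd_congr {U : Set (Fin 3 → ℝ)} (hU : IsOpen U) {F G : (Fin 3 → ℝ) → ℝ}
    (h : ∀ x ∈ U, F x = G x) (i : Fin 3) : ∀ x ∈ U, pd i F x = pd i G x := by
  intro x hx
  have : F =ᶠ[𝓝 x] G := by
    filter_upwards [hU.mem_nhds hx] with y hy using h y hy
  unfold pd
  rw [this.fderiv_eq]

lemma pd_of_has {F : (Fin 3 → ℝ) → ℝ} {L : (Fin 3 → ℝ) →L[ℝ] ℝ} {x : Fin 3 → ℝ}
    (h : HasFDerivAt F L x) (i : Fin 3) : pd i F x = L (Pi.single i 1) := by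
  unfold pd
  rw [h.fderiv]

lemma has_comp0 {h : ℝ → ℝ} {h' : ℝ} {x : Fin 3 → ℝ} (hh : HasDerivAt h h' (x 0)) :
    HasFDerivAt (fun y : Fin 3 → ℝ => h (y 0))
      (h' • (ContinuousLinearMap.proj 0 : (Fin 3 → ℝ) →L[ℝ] ℝ)) x := 
  HasDerivAt.comp_hasFDerivAt (f := fun y : Fin 3 → ℝ => y 0) x hh (hasFDerivAt_apply (𝕜 := ℝ) (0 : Fin 3) x)

lemma fderiv_zero_of_pd {F : (Fin 3 → ℝ) → ℝ} {x : Fin 3 → ℝ}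
    (h0 : pd 0 F x = 0) (h1 : pd 1 F x = 0) (h2 : pd 2 F x = 0) : fderiv ℝ F x = 0 := by
  apply ContinuousLinearMap.coe_injective
  apply LinearMap.pi_ext'
  intro i
  ext
  fin_cases i
  · simpa [pd] using h0
  · simpa [pd] using h1
  · simpa [pd] using h2

lemma const_of_pd {U : Set (Fin 3 → ℝ)} (hU : IsOpen U) (hc : Convex ℝ U)
    {F : (Fin 3 → ℝ) → ℝ} (hF : DifferentiableOn ℝ F U)
    (h0 : ∀ x ∈ U, pd 0 F x = 0) (h1 : ∀ x ∈ U, pd 1 F x = 0) (h2 : ∀ x ∈ U, pd 2 F x = 0) :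
    ∃ c, ∀ x ∈ U, F x = c := by
  exact hU.exists_is_const_of_fderiv_eq_zero hc.isPreconnected hF
    (fun x hx => fderiv_zero_of_pd (h0 x hx) (h1 x hx) (h2 x hx))

lemma pd_symm {U : Set (Fin 3 → ℝ)} (hU : IsOpen U) 
    {F : (Fin 3 → ℝ) → ℝ} (hF : ContDiffOn ℝ 2 F U) (i j : Fin 3) :
    ∀ x ∈ U, pd i (pd j F) x = pd j (pd i F) x := by
  intro x hx
  have hFx : ContDiffAt ℝ 2 F x := hF.contDiffAt (hU.mem_nhds hx)
  have hd : DifferentiableAt ℝ (fderiv ℝ F) x :=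
    (hFx.fderiv_right (m := 1) (by norm_num)).differentiableAt (by norm_num)
  have key : ∀ i j : Fin 3, pd i (pd j F) x
      = fderiv ℝ (fderiv ℝ F) x (Pi.single i 1) (Pi.single j 1) := by
    intro i j
    change fderiv ℝ (fun y => fderiv ℝ F y (Pi.single j 1)) x (Pi.single i 1) = _
    rw [fderiv_clm_apply hd (by fun_prop)]
    simp
  rw [key, key]
  exact (hFx.isSymmSndFDerivAt (by simp)) _ _

lemma pd_diff {U : Set (Fin 3 → ℝ)} (hU : IsOpen U) 
    {F : (Fin 3 → ℝ) → ℝ} (hF : ContDiffOn ℝ 2 F U) (j : Fin 3) :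
    ∀ x ∈ U, DifferentiableAt ℝ (pd j F) x := by
  intro x hx
  have hFx : ContDiffAt ℝ 2 F x := hF.contDiffAt (hU.mem_nhds hx)
  have hd : DifferentiableAt ℝ (fderiv ℝ F) x :=
    (hFx.fderiv_right (m := 1) (by norm_num)).differentiableAt (by norm_num)
  exact hd.clm_apply (differentiableAt_const _)

lemma line_deriv {P : (Fin 3 → ℝ) → ℝ} {x : Fin 3 → ℝ} {t : ℝ}
    (h : DifferentiableAt ℝ P (x + t • Pi.single 1 1)) :
    HasDerivAt (fun r : ℝ => P (x + r • Pi.single 1 1)) (pd 1 P (x + t • Pi.single 1 1)) t := by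
  have h1 : HasDerivAt (fun r : ℝ => x + r • (Pi.single 1 1 : Fin 3 → ℝ)) (Pi.single 1 1) t := by
    simpa using ((hasDerivAt_id t).smul_const (Pi.single 1 1 : Fin 3 → ℝ)).const_add x
  exact h.hasFDerivAt.comp_hasDerivAt t h1

/-- A function with vanishing `v`-derivative is invariant under `v`-translations inside `U`. -/
lemma shift_inv {U : Set (Fin 3 → ℝ)} (hU : IsOpen U) (hc : Convex ℝ U)
    {P : (Fin 3 → ℝ) → ℝ} (hP : ∀ x ∈ U, DifferentiableAt ℝ P x)
    (h1 : ∀ x ∈ U, pd 1 P x = 0) (x : Fin 3 → ℝ) (t : ℝ) (hx : x ∈ U)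
    (hxt : x + t • Pi.single 1 1 ∈ U) : P (x + t • Pi.single 1 1) = P x := by
  let T : Set ℝ := {r | x + r • (Pi.single 1 1 : Fin 3 → ℝ) ∈ U}
  have hTo : IsOpen T := hU.preimage (by fun_prop)
  have hTc : Convex ℝ T := by
    intro a ha b hb p q hp hq hpq
    have := hc ha hb hp hq hpq
    change x + (p • a + q • b) • (Pi.single 1 1 : Fin 3 → ℝ) ∈ U
    convert this using 1
    have hq' : q = 1 - p := by linarith
    subst hq'
    simp only [smul_eq_mul]
    module
  obtain ⟨c, hcst⟩ := hTo.exists_is_const_of_deriv_eq_zero hTc.isPreconnected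
    (f := fun r : ℝ => P (x + r • Pi.single 1 1))
    (fun r hr => (line_deriv (hP _ hr)).differentiableAt.differentiableWithinAt)
    (fun r hr => by rw [(line_deriv (hP _ hr)).deriv]; exact h1 _ hr)
  have e1 := hcst t hxt
  have e2 := hcst 0 (by simpa [T] using hx)
  simp only [zero_smul, add_zero] at e2
  rw [e2]; exact e1

/-- Characterisation of `C²` solutions on `U = (0,∞)³` (coordinates `(s,v,q) = (x 0, x 1, x 2)`)
of the system `g''(s) ∂F/∂v - ∂²F/∂s² = 0`, `w(s) ∂F/∂q + (1/2) ∂²F/∂v² = 0`,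
`∂²F/∂s∂v = 0`, for strictly convex `g`: exactly the functions
`c₁ (g s + v) + c₂ s + c₃`. -/
theorem statement2 (g w : ℝ → ℝ)
    (hg : ContDiffOn ℝ 2 g (Ioi 0))
    (hgpp : ∀ s ∈ Ioi (0:ℝ), 0 < deriv (deriv g) s)
    (hw : ContinuousOn w (Ioi 0)) (hwpos : ∀ s ∈ Ioi (0:ℝ), 0 < w s)
    (U : Set (Fin 3 → ℝ)) (hU : U = {x | 0 < x 0 ∧ 0 < x 1 ∧ 0 < x 2})
    (F : (Fin 3 → ℝ) → ℝ) (hF : ContDiffOn ℝ 2 F U) :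
    (∀ x ∈ U,
        deriv (deriv g) (x 0) * pd 1 F x - pd 0 (pd 0 F) x = 0 ∧
        w (x 0) * pd 2 F x + (1/2) * pd 1 (pd 1 F) x = 0 ∧
        pd 0 (pd 1 F) x = 0) ↔
      ∃ c₁ c₂ c₃ : ℝ, ∀ x ∈ U,
        F x = c₁ * (g (x 0) + x 1) + c₂ * x 0 + c₃ := by
  have hUo : IsOpen U := by
    rw [hU]
    exact (isOpen_lt continuous_const (continuous_apply 0)).inter
      ((isOpen_lt continuous_const (continuous_apply 1)).inter
        (isOpen_lt continuous_const (continuous_apply 2)))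
  have hUc : Convex ℝ U := by
    rw [hU]
    rintro x ⟨hx0, hx1, hx2⟩ y ⟨hy0, hy1, hy2⟩ a b ha hb hab
    have key : ∀ p q : ℝ, 0 < p → 0 < q → 0 < a * p + b * q := by
      intro p q hp hq
      exact convex_Ioi (0:ℝ) hp hq ha hb hab
    exact ⟨key _ _ hx0 hy0, key _ _ hx1 hy1, key _ _ hx2 hy2⟩
  have hU0 : ∀ x ∈ U, x 0 ∈ Ioi (0:ℝ) := by
    intro x hx
    rw [hU] at hx
    exact hx.1
  have hg1 : ∀ s ∈ Ioi (0:ℝ), HasDerivAt g (deriv g s) s := fun s hs =>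
    ((hg.contDiffAt (Ioi_mem_nhds hs)).differentiableAt (by norm_num)).hasDerivAt
  have hg2 : ∀ s ∈ Ioi (0:ℝ), HasDerivAt (deriv g) (deriv (deriv g) s) s := fun s hs =>
    (((hg.deriv_of_isOpen isOpen_Ioi (m := 1) (by norm_num)).contDiffAt
      (Ioi_mem_nhds hs)).differentiableAt (by norm_num)).hasDerivAt
  have hM : ∀ c₁ c₂ c₃ : ℝ, ∀ x ∈ U, HasFDerivAt
      (fun x : Fin 3 → ℝ => c₁ * (g (x 0) + x 1) + c₂ * x 0 + c₃)
      (c₁ • (deriv g (x 0) • (ContinuousLinearMap.proj 0 : (Fin 3 → ℝ) →L[ℝ] ℝ)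
        + (ContinuousLinearMap.proj 1 : (Fin 3 → ℝ) →L[ℝ] ℝ))
        + c₂ • (ContinuousLinearMap.proj 0 : (Fin 3 → ℝ) →L[ℝ] ℝ)) x := by
    intro c₁ c₂ c₃ x hx
    exact ((((has_comp0 (hg1 _ (hU0 x hx))).add (hasFDerivAt_apply (𝕜 := ℝ) (1 : Fin 3) x)).const_mul
      c₁).add ((hasFDerivAt_apply (𝕜 := ℝ) (0 : Fin 3) x).const_mul c₂)).add_const c₃
  have hN : ∀ c₁ c₂ : ℝ, ∀ x ∈ U, HasFDerivAt
      (fun x : Fin 3 → ℝ => c₁ * deriv g (x 0) + c₂)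
      (c₁ • (deriv (deriv g) (x 0) • (ContinuousLinearMap.proj 0 : (Fin 3 → ℝ) →L[ℝ] ℝ))) x := by
    intro c₁ c₂ x hx
    exact ((has_comp0 (hg2 _ (hU0 x hx))).const_mul c₁).add_const c₂
  have hFd : ∀ x ∈ U, DifferentiableAt ℝ F x := fun x hx =>
    (hF.contDiffAt (hUo.mem_nhds hx)).differentiableAt (by norm_num)
  constructor
  · intro h
    have hsv : ∀ x ∈ U, pd 0 (pd 1 F) x = 0 := fun x hx => (h x hx).2.2
    have hvs : ∀ x ∈ U, pd 1 (pd 0 F) x = 0 := fun x hx => by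
      rw [pd_symm hUo hF 1 0 x hx]; exact hsv x hx
    have hinv := shift_inv hUo hUc (pd_diff hUo hF 0) hvs
    have hFv : ∀ x ∈ U, ∀ t : ℝ, x + t • (Pi.single 1 1 : Fin 3 → ℝ) ∈ U →
        pd 1 F (x + t • Pi.single 1 1) = pd 1 F x := by
      intro x hx t hxt
      have hev : (fun y => pd 0 F (y + t • Pi.single 1 1)) =ᶠ[𝓝 x] pd 0 F := by
        have hn : ∀ᶠ y in 𝓝 x, y + t • (Pi.single 1 1 : Fin 3 → ℝ) ∈ U :=
          (hUo.preimage (f := fun y => y + t • (Pi.single 1 1 : Fin 3 → ℝ))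
            (by fun_prop)).mem_nhds hxt
        filter_upwards [hUo.mem_nhds hx, hn] with y hy hyt using hinv y t hy hyt
      have e : pd 0 (pd 0 F) (x + t • Pi.single 1 1) = pd 0 (pd 0 F) x := by
        have := hev.fderiv_eq (𝕜 := ℝ)
        rw [fderiv_comp_add_right] at this
        exact congrArg (fun L : (Fin 3 → ℝ) →L[ℝ] ℝ => L (Pi.single 0 1)) this
      have a1 := (h x hx).1
      have a2 := (h _ hxt).1
      have e0 : (x + t • (Pi.single 1 1 : Fin 3 → ℝ)) 0 = x 0 := by simp
      rw [e, e0] at a2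
      have hp := hgpp _ (hU0 x hx)
      apply mul_left_cancel₀ hp.ne'
      linarith
    have hvv : ∀ x ∈ U, pd 1 (pd 1 F) x = 0 := by
      intro x hx
      have hx' : x + (0:ℝ) • (Pi.single 1 1 : Fin 3 → ℝ) ∈ U := by simpa using hx
      have hd := line_deriv (P := pd 1 F) (x := x) (t := 0) (pd_diff hUo hF 1 _ hx')
      have hev : (fun r : ℝ => pd 1 F (x + r • Pi.single 1 1)) =ᶠ[𝓝 0] fun _ => pd 1 F x := by
        have hn : ∀ᶠ r : ℝ in 𝓝 0, x + r • (Pi.single 1 1 : Fin 3 → ℝ) ∈ U :=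
          (hUo.preimage (f := fun r : ℝ => x + r • (Pi.single 1 1 : Fin 3 → ℝ))
            (by fun_prop)).mem_nhds hx'
        filter_upwards [hn] with r hr using hFv x hx r hr
      have h0 := hev.deriv_eq
      rw [hd.deriv] at h0
      simpa using h0
    have hq : ∀ x ∈ U, pd 2 F x = 0 := by
      intro x hx
      have := (h x hx).2.1
      rw [hvv x hx] at this
      have hp := hwpos _ (hU0 x hx)
      apply mul_left_cancel₀ hp.ne'
      linarith
    have hzero : ∀ i : Fin 3, ∀ x ∈ U, pd 2 (pd i F) x = 0 := by
      intro i x hx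
      rw [pd_symm hUo hF 2 i x hx, pd_congr hUo (G := fun _ => 0) hq i x hx]
      simp [pd]
    obtain ⟨c₁, hc₁⟩ := const_of_pd hUo hUc
      (fun x hx => (pd_diff hUo hF 1 x hx).differentiableWithinAt) hsv hvv (hzero 1)
    have hH : ∀ x ∈ U, HasFDerivAt (fun x => pd 0 F x - (c₁ * deriv g (x 0) + 0)) _ x :=
      fun x hx => (pd_diff hUo hF 0 x hx).hasFDerivAt.sub (hN c₁ 0 x hx)
    obtain ⟨c₂, hc₂⟩ := const_of_pd hUo hUc
      (F := fun x => pd 0 F x - (c₁ * deriv g (x 0) + 0))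
      (fun x hx => (hH x hx).differentiableAt.differentiableWithinAt)
      (fun x hx => by
        rw [pd_of_has (hH x hx)]
        have a := (h x hx).1
        rw [hc₁ x hx] at a
        change pd 0 (pd 0 F) x - _ = 0
        simp
        linarith)
      (fun x hx => by
        rw [pd_of_has (hH x hx)]
        change pd 1 (pd 0 F) x - _ = 0
        rw [hvs x hx]
        simp)
      (fun x hx => by
        rw [pd_of_has (hH x hx)]
        change pd 2 (pd 0 F) x - _ = 0
        rw [hzero 0 x hx]
        simp)
    have hK : ∀ x ∈ U, HasFDerivAt (fun x => F x - (c₁ * (g (x 0) + x 1) + c₂ * x 0 + 0)) _ x :=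
      fun x hx => (hFd x hx).hasFDerivAt.sub (hM c₁ c₂ 0 x hx)
    obtain ⟨c₃, hc₃⟩ := const_of_pd hUo hUc
      (F := fun x => F x - (c₁ * (g (x 0) + x 1) + c₂ * x 0 + 0))
      (fun x hx => (hK x hx).differentiableAt.differentiableWithinAt)
      (fun x hx => by
        rw [pd_of_has (hK x hx)]
        have a := hc₂ x hx
        change pd 0 F x - _ = 0
        simp
        linarith)
      (fun x hx => by
        rw [pd_of_has (hK x hx)]
        change pd 1 F x - _ = 0
        rw [hc₁ x hx]
        simp)
      (fun x hx => by
        rw [pd_of_has (hK x hx)]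
        change pd 2 F x - _ = 0
        rw [hq x hx]
        simp)
    refine ⟨c₁, c₂, c₃, fun x hx => ?_⟩
    have := hc₃ x hx
    linarith
  · rintro ⟨c₁, c₂, c₃, h⟩
    have p0 : ∀ x ∈ U, pd 0 F x = c₁ * deriv g (x 0) + c₂ := fun x hx => by
      rw [pd_congr hUo h 0 x hx, pd_of_has (hM c₁ c₂ c₃ x hx)]
      simp
    have p1 : ∀ x ∈ U, pd 1 F x = c₁ := fun x hx => by
      rw [pd_congr hUo h 1 x hx, pd_of_has (hM c₁ c₂ c₃ x hx)]
      simp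
    have p2 : ∀ x ∈ U, pd 2 F x = 0 := fun x hx => by
      rw [pd_congr hUo h 2 x hx, pd_of_has (hM c₁ c₂ c₃ x hx)]
      simp
    intro x hx
    have q1 : ∀ i, pd i (pd 1 F) x = 0 := fun i => by
      rw [pd_congr hUo (G := fun _ => c₁) p1 i x hx]
      simp [pd]
    refine ⟨?_, ?_, q1 0⟩
    · rw [p1 x hx, pd_congr hUo p0 0 x hx, pd_of_has (hN c₁ c₂ x hx)]
      simp
      ring
    · rw [p2 x hx, q1 1]
      simp
end

section
/- Let W ⊆ ℝ × (0,∞) × ℝ be open and let F : W → ℝ be twice continuously differentiable, satisfying the drawdown PDE ∂F/∂x₃ + ∂F/∂x₂ + (1/2)·∂²F/∂x₁² + 2x₂·∂²F/∂x₂² − 2√(x₂)·∂²F/∂x₁∂x₂ = 0 at every point of W. Define y : ℝ³ → ℝ³ by y(x₁,x₂,x₃) = (x₁, (x₂−x₁)², x₃), let E = {x ∈ ℝ³ : x₂ > x₁ and y(x) ∈ W}, and set F^M := F ∘ y on E. Then F^M is twice continuously differentiable on E and satisfies ∂F^M/∂x₃ + (1/2)·∂²F^M/∂x₁² = 0 at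 every point of E; moreover ∂F^M/∂x₂(x) = 2(x₂−x₁)·(∂F/∂x₂)(y(x)) for every x ∈ E, so that in particular ∂F^M/∂x₂(x) tends to 0 as x approaches the diagonal {x₁ = x₂} whenever ∂F/∂x₂ extends continuously to points of the closure of W with vanishing second coordinate. -/
open Set Filter

/-- The change of variables. -/
noncomputable def yMap (x : Fin 3 → ℝ) : Fin 3 → ℝ := ![x 0, (x 1 - x 0) ^ 2, x 2]

/-- Its derivative. -/
noncomputable def yDer (x : Fin 3 → ℝ) : (Fin 3 → ℝ) →L[ℝ] (Fin 3 → ℝ) :=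
  ContinuousLinearMap.pi ![ContinuousLinearMap.proj 0,
    (2 * (x 1 - x 0)) • (ContinuousLinearMap.proj (R := ℝ) (φ := fun _ : Fin 3 => ℝ) 1
      - ContinuousLinearMap.proj 0),
    ContinuousLinearMap.proj 2]

theorem yMap_contDiff : ContDiff ℝ 2 yMap := by
  rw [contDiff_pi]
  intro i
  fin_cases i <;> simp [yMap] <;> fun_prop

theorem yMap_hasFDerivAt (x : Fin 3 → ℝ) : HasFDerivAt yMap (yDer x) x := by
  rw [hasFDerivAt_pi']
  have h0 : ∀ i : Fin 3, HasFDerivAt (fun x : Fin 3 → ℝ => x i)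
    (ContinuousLinearMap.proj (R := ℝ) (φ := fun _ : Fin 3 => ℝ) i) x :=
    fun i => hasFDerivAt_apply i x
  intro i
  fin_cases i
  · exact h0 0
  · have := ((h0 1).sub (h0 0)).pow 2
    refine this.congr_fderiv ?_
    ext v
    simp [yDer]
  · exact h0 2

theorem yDer_zero (x : Fin 3 → ℝ) :
    yDer x (Pi.single 0 1) = Pi.single 0 1 - (2 * (x 1 - x 0)) • Pi.single 1 1 := by
  ext i
  fin_cases i <;> simp [yDer]

theorem yDer_one (x : Fin 3 → ℝ) :
    yDer x (Pi.single 1 1) = (2 * (x 1 - x 0)) • Pi.single 1 1 := by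
  ext i
  fin_cases i <;> simp [yDer]

theorem yDer_two (x : Fin 3 → ℝ) :
    yDer x (Pi.single 2 1) = Pi.single 2 1 := by
  ext i
  fin_cases i <;> simp [yDer]

theorem pd_comp (g : (Fin 3 → ℝ) → ℝ) (x : Fin 3 → ℝ) (hg : DifferentiableAt ℝ g (yMap x)) :
    pd 0 (g ∘ yMap) x = pd 0 g (yMap x) - 2 * (x 1 - x 0) * pd 1 g (yMap x) ∧
    pd 1 (g ∘ yMap) x = 2 * (x 1 - x 0) * pd 1 g (yMap x) ∧
    pd 2 (g ∘ yMap) x = pd 2 g (yMap x) := by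
  have h := (hg.hasFDerivAt.comp x (yMap_hasFDerivAt x)).fderiv
  simp only [pd, h, ContinuousLinearMap.comp_apply, yDer_zero, yDer_one, yDer_two, map_sub,
    map_smul, smul_eq_mul, and_self]

theorem pd_diff_s4 {W : Set (Fin 3 → ℝ)} (hW : IsOpen W) {F : (Fin 3 → ℝ) → ℝ}
    (hF : ContDiffOn ℝ 2 F W) {z : Fin 3 → ℝ} (hz : z ∈ W) :
    DifferentiableAt ℝ (fderiv ℝ F) z := by
  have h := hF.contDiffAt (hW.mem_nhds hz)
  exact (h.fderiv_right (m := 1) (by norm_num)).differentiableAt (by norm_num)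

theorem pd_pd {F : (Fin 3 → ℝ) → ℝ} {z : Fin 3 → ℝ}
    (h : DifferentiableAt ℝ (fderiv ℝ F) z) (i j : Fin 3) :
    pd i (pd j F) z = fderiv ℝ (fderiv ℝ F) z (Pi.single i 1) (Pi.single j 1) := by
  have := h.hasFDerivAt.clm_apply (hasFDerivAt_const (Pi.single j (1 : ℝ)) z)
  unfold pd
  rw [this.fderiv]
  simp

theorem pd_symm_s4 {W : Set (Fin 3 → ℝ)} (hW : IsOpen W) {F : (Fin 3 → ℝ) → ℝ}
    (hF : ContDiffOn ℝ 2 F W) {z : Fin 3 → ℝ} (hz : z ∈ W) :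
    pd 1 (pd 0 F) z = pd 0 (pd 1 F) z := by
  have h := pd_diff_s4 hW hF hz
  rw [pd_pd h, pd_pd h]
  have h' := hF.contDiffAt (hW.mem_nhds hz)
  exact (h'.isSymmSndFDerivAt (by simp)) _ _

/-- Forward direction of the drawdown / running-maximum change of variables: if `F` solves the
drawdown PDE on an open `W ⊆ ℝ × (0,∞) × ℝ`, then `F^M = F ∘ y` with
`y x = (x₁, (x₂ - x₁)², x₃)` is `C²` on `E = {x₁ < x₂, y x ∈ W}`, solves the heat equation
`∂F^M/∂x₃ + (1/2) ∂²F^M/∂x₁² = 0` there, satisfies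
`∂F^M/∂x₂ x = 2 (x₂ - x₁) ∂F/∂x₂ (y x)`, and in particular `∂F^M/∂x₂` tends to `0` at points of
the diagonal whenever `∂F/∂x₂` extends continuously to the closure of `W`. -/
theorem statement4 (W : Set (Fin 3 → ℝ)) (hWopen : IsOpen W)
    (hWsub : W ⊆ {x | 0 < x 1})
    (F : (Fin 3 → ℝ) → ℝ) (hF : ContDiffOn ℝ 2 F W)
    (hPDE : ∀ x ∈ W,
      pd 2 F x + pd 1 F x + (1/2) * pd 0 (pd 0 F) x
        + 2 * x 1 * pd 1 (pd 1 F) x - 2 * Real.sqrt (x 1) * pd 0 (pd 1 F) x = 0)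
    (y : (Fin 3 → ℝ) → (Fin 3 → ℝ)) (hy : ∀ x, y x = ![x 0, (x 1 - x 0) ^ 2, x 2])
    (E : Set (Fin 3 → ℝ)) (hE : E = {x | x 0 < x 1 ∧ y x ∈ W}) :
    ContDiffOn ℝ 2 (F ∘ y) E ∧
    (∀ x ∈ E, pd 2 (F ∘ y) x + (1/2) * pd 0 (pd 0 (F ∘ y)) x = 0) ∧
    (∀ x ∈ E, pd 1 (F ∘ y) x = 2 * (x 1 - x 0) * pd 1 F (y x)) ∧
    (∀ G : (Fin 3 → ℝ) → ℝ, ContinuousOn G (closure W) → (∀ x ∈ W, G x = pd 1 F x) →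
      ∀ p : Fin 3 → ℝ, p 0 = p 1 → y p ∈ closure W →
        Tendsto (fun x => pd 1 (F ∘ y) x) (nhdsWithin p E) (nhds 0)) := by
  obtain rfl : y = yMap := funext hy
  subst hE
  have hdF : ∀ z ∈ W, DifferentiableAt ℝ F z := fun z hz =>
    (hF.contDiffAt (hWopen.mem_nhds hz)).differentiableAt (by norm_num)
  have hcont : Continuous yMap := yMap_contDiff.continuous
  have h1 : ∀ x ∈ {x | x 0 < x 1 ∧ yMap x ∈ W},
      pd 1 (F ∘ yMap) x = 2 * (x 1 - x 0) * pd 1 F (yMap x) :=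
    fun x hx => (pd_comp F x (hdF _ hx.2)).2.1
  refine ⟨hF.comp yMap_contDiff.contDiffOn (fun x hx => hx.2), ?_, h1, ?_⟩
  · rintro x ⟨hlt, hx⟩
    have hd := pd_diff_s4 hWopen hF hx
    have hdi : ∀ i, DifferentiableAt ℝ (pd i F) (yMap x) := fun i =>
      hd.clm_apply (differentiableAt_const _)
    have hev : pd 0 (F ∘ yMap) =ᶠ[nhds x]
        fun x => (pd 0 F ∘ yMap) x - 2 * (x 1 - x 0) * (pd 1 F ∘ yMap) x := by
      filter_upwards [(hWopen.preimage hcont).mem_nhds hx] with u hu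
      exact (pd_comp F u (hdF _ hu)).1
    have hc : ∀ i, HasFDerivAt (pd i F ∘ yMap) (fderiv ℝ (pd i F ∘ yMap) x) x := fun i =>
      ((hdi i).comp x (yMap_hasFDerivAt x).differentiableAt).hasFDerivAt
    have hp : ∀ i : Fin 3, HasFDerivAt (fun x : Fin 3 → ℝ => x i)
      (ContinuousLinearMap.proj (R := ℝ) (φ := fun _ : Fin 3 => ℝ) i) x :=
      fun i => hasFDerivAt_apply i x
    have hD := (hc 0).sub ((((hp 1).sub (hp 0)).const_mul 2).mul (hc 1))
    have h00 : pd 0 (pd 0 (F ∘ yMap)) x = pd 0 (pd 0 F ∘ yMap) x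
        - (2 * (x 1 - x 0) * pd 0 (pd 1 F ∘ yMap) x - 2 * pd 1 F (yMap x)) := by
      have e : fderiv ℝ (pd 0 (F ∘ yMap)) x = _ := hev.fderiv_eq.trans hD.fderiv
      rw [pd, e]
      simp [pd]
      ring
    have hs : Real.sqrt (yMap x 1) = x 1 - x 0 := by
      have : yMap x 1 = (x 1 - x 0) ^ 2 := rfl
      rw [this, Real.sqrt_sq (by linarith)]
    have hq : yMap x 1 = (x 1 - x 0) ^ 2 := rfl
    have hP := hPDE _ hx
    rw [hs, hq] at hP
    rw [h00, (pd_comp F x (hdF _ hx)).2.2, (pd_comp _ x (hdi 0)).1, (pd_comp _ x (hdi 1)).1,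
      pd_symm_s4 hWopen hF hx]
    linear_combination hP
  · intro G hG hGe p hp hpW
    have hy' : Tendsto yMap (nhdsWithin p {x | x 0 < x 1 ∧ yMap x ∈ W})
        (nhdsWithin (yMap p) (closure W)) := by
      refine tendsto_nhdsWithin_iff.2 ⟨hcont.continuousAt.mono_left nhdsWithin_le_nhds, ?_⟩
      filter_upwards [self_mem_nhdsWithin] with x hx
      exact subset_closure hx.2
    have hGt := (hG _ hpW).tendsto.comp hy'
    have hl : Tendsto (fun x : Fin 3 → ℝ => 2 * (x 1 - x 0))
        (nhdsWithin p {x | x 0 < x 1 ∧ yMap x ∈ W}) (nhds (2 * (p 1 - p 0))) :=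
      (Continuous.tendsto (by fun_prop) p).mono_left nhdsWithin_le_nhds
    have hm := hl.mul hGt
    rw [hp, sub_self, mul_zero, zero_mul] at hm
    refine hm.congr' ?_
    filter_upwards [self_mem_nhdsWithin] with x hx
    rw [h1 x hx, Function.comp_apply, hGe _ hx.2]
end

section
/- Let D ⊆ {x ∈ ℝ³ : x₁ < x₂} be open and let F : D → ℝ be twice continuously differentiable, satisfying ∂F/∂x₃ + (1/2)·∂²F/∂x₁² = 0 at every point of D. Define ỹ : ℝ × [0,∞) × ℝ → ℝ³ by ỹ(x₁,x₂,x₃) = (x₁, x₁ + √(x₂), x₃), let E = {x ∈ ℝ³ : x₂ > 0 and ỹ(x) ∈ D}, and set F^D := F ∘ ỹ on E. Then F^D is twice continuously differentiable on E and satisfies the drawdown PDE ∂F^D/∂x₃ + ∂F^D/∂x₂ + (1/2)·∂²F^D/∂x₁² + 2x₂·∂²F^D/∂x₂² − 2√(x₂)·∂²F^D/∂x₁∂x₂ = 0 at every point of E. -/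
open Set

lemma single_decomp (a b c : ℝ) :
    (![a, b, c] : Fin 3 → ℝ) = a • Pi.single 0 1 + b • Pi.single 1 1 + c • Pi.single 2 1 := by
  ext i; fin_cases i <;> simp

lemma hasFDerivAt_ytil (x : Fin 3 → ℝ) (hx : 0 < x 1) :
    ∃ L : (Fin 3 → ℝ) →L[ℝ] (Fin 3 → ℝ),
      HasFDerivAt (fun x : Fin 3 → ℝ => (![x 0, x 0 + Real.sqrt (x 1), x 2] : Fin 3 → ℝ)) L x ∧
      ∀ v, L v = ![v 0, v 0 + (1 / (2 * Real.sqrt (x 1))) * v 1, v 2] := by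
  have h (i : Fin 3) : HasFDerivAt (fun x : Fin 3 → ℝ => x i)
      (ContinuousLinearMap.proj (R := ℝ) (φ := fun _ : Fin 3 => ℝ) i) x := hasFDerivAt_apply i x
  have h1 := (h 0).add ((h 1).sqrt hx.ne')
  refine ⟨ContinuousLinearMap.pi ![ContinuousLinearMap.proj 0,
    ContinuousLinearMap.proj 0 + (1 / (2 * √(x 1))) • ContinuousLinearMap.proj 1,
    ContinuousLinearMap.proj 2], hasFDerivAt_pi'' (fun i => ?_), fun v => ?_⟩
  · fin_cases i
    · exact h 0
    · exact h1
    · exact h 2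
  · ext i
    fin_cases i <;> simp

lemma pd_comp_s5 (H : (Fin 3 → ℝ) → ℝ) (ytil : (Fin 3 → ℝ) → (Fin 3 → ℝ))
    (hy : ∀ x, ytil x = ![x 0, x 0 + Real.sqrt (x 1), x 2]) (x : Fin 3 → ℝ) (hx : 0 < x 1)
    (hH : DifferentiableAt ℝ H (ytil x)) :
    DifferentiableAt ℝ (fun z => H (ytil z)) x ∧
    pd 0 (fun z => H (ytil z)) x = pd 0 H (ytil x) + pd 1 H (ytil x) ∧
    pd 1 (fun z => H (ytil z)) x = pd 1 H (ytil x) * (1 / (2 * Real.sqrt (x 1))) ∧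
    pd 2 (fun z => H (ytil z)) x = pd 2 H (ytil x) := by
  obtain ⟨L, hL, hLv⟩ := hasFDerivAt_ytil x hx
  rw [← funext hy] at hL
  have hc : HasFDerivAt (fun z => H (ytil z)) _ x := hH.hasFDerivAt.comp x hL
  refine ⟨hc.differentiableAt, ?_, ?_, ?_⟩ <;>
  · unfold pd
    rw [hc.fderiv, ContinuousLinearMap.comp_apply, hLv, single_decomp]
    simp [mul_comm]

lemma pd_congr_s5 {n : ℕ} (i : Fin n) {G H : (Fin n → ℝ) → ℝ} {x : Fin n → ℝ}
    (h : G =ᶠ[nhds x] H) : pd i G x = pd i H x := by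
  unfold pd; rw [h.fderiv_eq]

lemma pd_add {n : ℕ} (i : Fin n) {G H : (Fin n → ℝ) → ℝ} {x : Fin n → ℝ}
    (hG : DifferentiableAt ℝ G x) (hH : DifferentiableAt ℝ H x) :
    pd i (fun z => G z + H z) x = pd i G x + pd i H x := by
  unfold pd; rw [(hG.hasFDerivAt.fun_add hH.hasFDerivAt).fderiv]; rfl

lemma pd_mul {n : ℕ} (i : Fin n) {G H : (Fin n → ℝ) → ℝ} {x : Fin n → ℝ}
    (hG : DifferentiableAt ℝ G x) (hH : DifferentiableAt ℝ H x) :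
    pd i (fun z => G z * H z) x = G x * pd i H x + H x * pd i G x := by
  unfold pd; rw [(hG.hasFDerivAt.fun_mul hH.hasFDerivAt).fderiv]; simp

lemma pd_weight (x : Fin 3 → ℝ) (hx : 0 < x 1) :
    DifferentiableAt ℝ (fun z : Fin 3 → ℝ => 1 / (2 * Real.sqrt (z 1))) x ∧
    pd 0 (fun z : Fin 3 → ℝ => 1 / (2 * Real.sqrt (z 1))) x = 0 ∧
    pd 1 (fun z : Fin 3 → ℝ => 1 / (2 * Real.sqrt (z 1))) x
      = - (1 / (4 * Real.sqrt (x 1) ^ 3)) := by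
  have h : HasFDerivAt (fun x : Fin 3 → ℝ => x 1)
      (ContinuousLinearMap.proj (R := ℝ) (φ := fun _ : Fin 3 => ℝ) 1) x := hasFDerivAt_apply 1 x
  have hs : 0 < Real.sqrt (x 1) := Real.sqrt_pos.2 hx
  have hd : HasDerivAt (fun t : ℝ => 1 / (2 * Real.sqrt t))
      (- (1 / (4 * Real.sqrt (x 1) ^ 3))) (x 1) := by
    have h2 := ((Real.hasDerivAt_sqrt hx.ne').const_mul 2).inv (by positivity)
    have e : (fun t : ℝ => 1 / (2 * Real.sqrt t)) = (fun y => 2 * Real.sqrt y)⁻¹ := by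
      ext t; simp
    rw [e]
    refine h2.congr_deriv ?_
    field_simp
    norm_num
  have hc : HasFDerivAt (fun z : Fin 3 → ℝ => 1 / (2 * Real.sqrt (z 1))) _ x :=
    HasDerivAt.comp_hasFDerivAt (h₂ := fun t : ℝ => 1 / (2 * Real.sqrt t)) x hd h
  refine ⟨hc.differentiableAt, ?_, ?_⟩ <;>
  · unfold pd
    rw [hc.fderiv]
    simp

lemma pd_diff_s5 {F : (Fin 3 → ℝ) → ℝ} {x : Fin 3 → ℝ} (h : ContDiffAt ℝ 2 F x) (i : Fin 3) :
    DifferentiableAt ℝ (pd i F) x := by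
  have h1 : DifferentiableAt ℝ (fderiv ℝ F) x :=
    (h.fderiv_right (m := 1) (by norm_num)).differentiableAt (by norm_num)
  exact h1.clm_apply (differentiableAt_const _)

lemma pd_symm_s5 {F : (Fin 3 → ℝ) → ℝ} {x : Fin 3 → ℝ} (h : ContDiffAt ℝ 2 F x) (i j : Fin 3) :
    pd i (pd j F) x = pd j (pd i F) x := by
  have h1 : DifferentiableAt ℝ (fderiv ℝ F) x :=
    (h.fderiv_right (m := 1) (by norm_num)).differentiableAt (by norm_num)
  have key (i j : Fin 3) :
      pd i (pd j F) x = fderiv ℝ (fderiv ℝ F) x (Pi.single i 1) (Pi.single j 1) := by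
    have := h1.hasFDerivAt.clm_apply (hasFDerivAt_const (Pi.single j (1:ℝ) : Fin 3 → ℝ) x)
    unfold pd
    rw [this.fderiv]
    simp
  rw [key, key]
  exact (h.isSymmSndFDerivAt (by simp)) _ _

/-- Converse direction of the drawdown / running-maximum change of variables: if `F` solves
`∂F/∂x₃ + (1/2) ∂²F/∂x₁² = 0` on an open `D ⊆ {x₁ < x₂}`, then `F^D = F ∘ ỹ` with
`ỹ x = (x₁, x₁ + √x₂, x₃)` is `C²` on `E = {x₂ > 0, ỹ x ∈ D}` and solves the drawdown PDE
`∂F^D/∂x₃ + ∂F^D/∂x₂ + (1/2) ∂²F^D/∂x₁² + 2 x₂ ∂²F^D/∂x₂² - 2 √x₂ ∂²F^D/∂x₁∂x₂ = 0` there. -/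
theorem statement5 (D : Set (Fin 3 → ℝ)) (hDopen : IsOpen D)
    (hDsub : D ⊆ {x | x 0 < x 1})
    (F : (Fin 3 → ℝ) → ℝ) (hF : ContDiffOn ℝ 2 F D)
    (hPDE : ∀ x ∈ D, pd 2 F x + (1/2) * pd 0 (pd 0 F) x = 0)
    (ytil : (Fin 3 → ℝ) → (Fin 3 → ℝ))
    (hy : ∀ x, ytil x = ![x 0, x 0 + Real.sqrt (x 1), x 2])
    (E : Set (Fin 3 → ℝ)) (hE : E = {x | 0 < x 1 ∧ ytil x ∈ D}) :
    ContDiffOn ℝ 2 (F ∘ ytil) E ∧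
    ∀ x ∈ E,
      pd 2 (F ∘ ytil) x + pd 1 (F ∘ ytil) x + (1/2) * pd 0 (pd 0 (F ∘ ytil)) x
        + 2 * x 1 * pd 1 (pd 1 (F ∘ ytil)) x
        - 2 * Real.sqrt (x 1) * pd 0 (pd 1 (F ∘ ytil)) x = 0 := by
  have hyc : ∀ x : Fin 3 → ℝ, 0 < x 1 → ContDiffAt ℝ 2 ytil x := by
    intro x hx
    rw [funext hy]
    have hp (i : Fin 3) : ContDiffAt ℝ 2 (fun z : Fin 3 → ℝ => z i) x :=
      (contDiff_apply ℝ ℝ i).contDiffAt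
    rw [contDiffAt_pi]
    intro i
    fin_cases i
    · exact hp 0
    · exact (hp 0).add ((hp 1).sqrt hx.ne')
    · exact hp 2
  have hFc : ∀ z ∈ D, ContDiffAt ℝ 2 F z := fun z hz => hF.contDiffAt (hDopen.mem_nhds hz)
  subst hE
  refine ⟨fun x hx => ((hFc _ hx.2).comp x (hyc x hx.1)).contDiffWithinAt, ?_⟩
  rintro x ⟨hx, hxD⟩
  have hev : ∀ᶠ z in nhds x, 0 < z 1 ∧ ytil z ∈ D :=
    ((continuous_apply 1).continuousAt.eventually (lt_mem_nhds hx)).and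
      ((hyc x hx).continuousAt.eventually (hDopen.mem_nhds hxD))
  have hdF : ∀ z ∈ D, DifferentiableAt ℝ F z :=
    fun z hz => (hFc z hz).differentiableAt (by norm_num)
  have e0 : pd 0 (F ∘ ytil) =ᶠ[nhds x] fun z => pd 0 F (ytil z) + pd 1 F (ytil z) := by
    filter_upwards [hev] with z hz
    exact (pd_comp_s5 F ytil hy z hz.1 (hdF _ hz.2)).2.1
  have e1 : pd 1 (F ∘ ytil) =ᶠ[nhds x]
      fun z => pd 1 F (ytil z) * (1 / (2 * Real.sqrt (z 1))) := by
    filter_upwards [hev] with z hz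
    exact (pd_comp_s5 F ytil hy z hz.1 (hdF _ hz.2)).2.2.1
  have e2 : pd 2 (F ∘ ytil) x = pd 2 F (ytil x) :=
    (pd_comp_s5 F ytil hy x hx (hdF _ hxD)).2.2.2
  obtain ⟨d0, a00, a01, -⟩ := pd_comp_s5 (pd 0 F) ytil hy x hx (pd_diff_s5 (hFc _ hxD) 0)
  obtain ⟨d1, a10, a11, -⟩ := pd_comp_s5 (pd 1 F) ytil hy x hx (pd_diff_s5 (hFc _ hxD) 1)
  obtain ⟨dw, w0, w1⟩ := pd_weight x hx
  have hsym := pd_symm_s5 (hFc _ hxD) 0 1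
  have hp := hPDE _ hxD
  rw [e2, e1.eq_of_nhds, pd_congr_s5 0 e0, pd_congr_s5 1 e1, pd_congr_s5 0 e1, pd_add 0 d0 d1,
    pd_mul 1 d1 dw, pd_mul 0 d1 dw, a00, a10, a11, w0, w1, hsym]
  have hs : 0 < Real.sqrt (x 1) := Real.sqrt_pos.2 hx
  have hsq : x 1 = Real.sqrt (x 1) ^ 2 := (Real.sq_sqrt hx.le).symm
  generalize Real.sqrt (x 1) = s at *
  rw [hsq]
  have hp' : pd 2 F (ytil x) = - ((1/2) * pd 0 (pd 0 F) (ytil x)) := by linarith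
  rw [hp']
  field_simp
  ring
end

section
/- Let S₀ > 0, let d ≥ 3, let 0 = k₁ < k₂ < … < k_d be real numbers, and let C₂, …, C_d ∈ ℝ with C₁ := S₀. Define the slopes D_i := (C_i − C_{i−1})/(k_i − k_{i−1}) for i = 2, …, d. Assume: C_i > (S₀ − k_i)⁺ for every i ∈ {2,…,d}; D₂ < D₃ < … < D_d; D₂ > −1; and D_d < 0. Then there exists a Borel probability measure μ on (0,∞) such that μ((a,b)) > 0 for all 0 < a < b, ∫ x dμ(x) = S₀, and ∫ (x − k_i)⁺ dμ(x) = C_i for every i ∈ {2,…,d}. -/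
open MeasureTheory Set

lemma call_integrable (ρ : Measure ℝ) [IsFiniteMeasure ρ] (h : Integrable (fun x => x) ρ) (c : ℝ) :
    Integrable (fun x => max (x - c) 0) ρ :=
  (h.sub (integrable_const c)).pos_part

lemma dirac_integrable (p c : ℝ) (f : ℝ → ℝ) :
    Integrable f (ENNReal.ofReal p • Measure.dirac c) :=
  (integrable_dirac (by simp)).smul_measure ENNReal.ofReal_ne_top

lemma call_shift (ρ : Measure ℝ) [IsFiniteMeasure ρ] (h : Integrable (fun x => x) ρ) (c e : ℝ)
    (hce : c ≤ e) (h0 : ρ (Iio e) = 0) :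
    ∫ x, max (x - c) 0 ∂ρ = (∫ x, max (x - e) 0 ∂ρ) + (e - c) * ρ.real univ := by
  have : ∫ x, max (x - c) 0 ∂ρ = ∫ x, (max (x - e) 0 + (e - c)) ∂ρ := by
    apply integral_congr_ae
    have : ∀ᵐ x ∂ρ, x ∉ Iio e := measure_eq_zero_iff_ae_notMem.mp h0
    filter_upwards [this] with x hx
    simp only [mem_Iio, not_lt] at hx
    rw [max_eq_left (by linarith), max_eq_left (by linarith)]
    ring
  rw [this, integral_add (call_integrable ρ h e) (integrable_const _), integral_const]
  simp [mul_comm]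

/-- adding a Dirac mass -/
lemma add_dirac_facts (ρ : Measure ℝ) [IsFiniteMeasure ρ] (h : Integrable (fun x => x) ρ)
    (p c : ℝ) (hp : 0 ≤ p) :
    IsFiniteMeasure (ρ + ENNReal.ofReal p • Measure.dirac c) ∧
    Integrable (fun x => x) (ρ + ENNReal.ofReal p • Measure.dirac c) ∧
    (ρ + ENNReal.ofReal p • Measure.dirac c).real univ = ρ.real univ + p ∧
    ∀ e, ∫ x, max (x - e) 0 ∂(ρ + ENNReal.ofReal p • Measure.dirac c)
      = (∫ x, max (x - e) 0 ∂ρ) + p * max (c - e) 0 := by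
  have hf : IsFiniteMeasure (ENNReal.ofReal p • Measure.dirac c) :=
    Measure.smul_finite _ ENNReal.ofReal_ne_top
  refine ⟨inferInstance, h.add_measure (dirac_integrable _ _ _), ?_, ?_⟩
  · rw [measureReal_add_apply, measureReal_ennreal_smul_apply]
    simp [hp]
  · intro e
    rw [integral_add_measure (call_integrable ρ h e) (dirac_integrable _ _ _),
      integral_smul_measure, integral_dirac]
    simp [hp]

lemma tail_measure (d : ℕ) (k C D : ℕ → ℝ)
    (hkmono : ∀ i, 1 ≤ i → i < d → k i < k (i + 1))
    (hD : ∀ i, 1 ≤ i → i < d → D (i + 1) * (k (i + 1) - k i) = C (i + 1) - C i)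
    (hCd : 0 < C d)
    (hDmono : ∀ i, 2 ≤ i → i < d → D i < D (i + 1)) (hDd : D d < 0) :
    ∀ n i, 2 ≤ i → i + n = d → ∀ s, (i < d → s < D (i + 1)) → (i = d → s < 0) →
    ∃ ρ : Measure ℝ, IsFiniteMeasure ρ ∧ Integrable (fun x => x) ρ ∧ ρ (Iio (k i)) = 0 ∧
      ρ.real univ = -s ∧ ∀ j, i ≤ j → j ≤ d → k i ≤ k j ∧ ∫ x, max (x - k j) 0 ∂ρ = C j := by
  intro n
  induction n with
  | zero =>
    intro i hi hid s _ hs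
    have hid : i = d := by omega
    subst hid
    have hs := hs rfl
    obtain ⟨h1, h2, h3, h4⟩ := add_dirac_facts 0 (integrable_zero_measure) (-s)
      (k i + C i / (-s)) (by linarith)
    have hq : 0 < C i / (-s) := div_pos hCd (by linarith)
    refine ⟨_, h1, h2, ?_, by simpa using h3, ?_⟩
    · have : ¬ (k i + C i / (-s) < k i) := by linarith
      simp only [zero_add, Measure.smul_apply, Measure.dirac_apply' _ measurableSet_Iio, smul_eq_mul]
      rw [indicator_of_notMem (by simpa using this), mul_zero]
    · intro j hj hj'
      have : j = i := by omega
      subst this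
      refine ⟨le_rfl, ?_⟩
      rw [h4, add_sub_cancel_left, max_eq_left hq.le, mul_div_cancel₀ _ (by linarith)]
      simp
  | succ n ih =>
    intro i hi hid s hs _
    have hid' : i < d := by omega
    have hs := hs hid'
    obtain ⟨ρ, hf, hint, h0, hm, hc⟩ := ih (i + 1) (by omega) (by omega) (D (i + 1))
      (fun h => hDmono _ (by omega) h) (fun h => by rw [h]; exact hDd)
    have hk := hkmono i (by omega) hid'
    obtain ⟨h1, h2, h3, h4⟩ := add_dirac_facts ρ hint (D (i + 1) - s) (k i) (by linarith)
    refine ⟨_, h1, h2, ?_, ?_, ?_⟩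
    · have h0' : ρ (Iio (k i)) = 0 := measure_mono_null (Iio_subset_Iio hk.le) h0
      simp [h0', Measure.dirac_apply' _ measurableSet_Iio]
    · rw [h3, hm]; ring
    · intro j hj hj'
      rw [h4]
      rcases eq_or_lt_of_le hj with rfl | hj
      · refine ⟨le_rfl, ?_⟩
        rw [call_shift ρ hint _ _ hk.le h0, (hc _ le_rfl (by omega)).2, hm]
        have := hD i (by omega) hid'
        simp only [sub_self, max_self]
        linarith
      · obtain ⟨ha, hb⟩ := hc j hj hj'
        refine ⟨by linarith, ?_⟩
        rw [hb, max_eq_right (by linarith)]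
        ring

lemma discrete_measure (M : ℝ) (d : ℕ) (hd : 3 ≤ d) (k C D : ℕ → ℝ) (hk1 : k 1 = 0)
    (hkmono : ∀ i, 1 ≤ i → i < d → k i < k (i + 1))
    (hD : ∀ i, 1 ≤ i → i < d → D (i + 1) * (k (i + 1) - k i) = C (i + 1) - C i)
    (hCd : 0 < C d)
    (hDmono : ∀ i, 2 ≤ i → i < d → D i < D (i + 1)) (hD2 : -M < D 2) (hDd : D d < 0) :
    ∃ ρ : Measure ℝ, IsFiniteMeasure ρ ∧ Integrable (fun x => x) ρ ∧ ρ (Iic 0) = 0 ∧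
      ρ.real univ = M ∧ ∀ j, 1 ≤ j → j ≤ d → ∫ x, max (x - k j) 0 ∂ρ = C j := by
  have h23 := hDmono 2 le_rfl (by omega)
  obtain ⟨s, hs1, hs2⟩ := exists_between h23
  obtain ⟨ρ, hf, hint, h0, hm, hc⟩ := tail_measure d k C D hkmono hD hCd hDmono hDd (d - 2) 2
    le_rfl (by omega) s (fun _ => hs2) (fun h => by omega)
  have hk := hkmono 1 le_rfl (by omega)
  norm_num [hk1] at hk
  have hD1 := hD 1 le_rfl (by omega)
  norm_num [hk1] at hD1
  have hMs : 0 < M + s := by linarith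
  set a := (s - D 2) * k 2 / (M + s) with ha
  have ha0 : 0 < a := div_pos (mul_pos (by linarith) hk) hMs
  have ha' : (M + s) * a = (s - D 2) * k 2 := by rw [ha]; field_simp
  have hak : a < k 2 := by
    rw [ha, div_lt_iff₀ hMs]; nlinarith
  obtain ⟨h1, h2, h3, h4⟩ := add_dirac_facts ρ hint (M + s) a hMs.le
  refine ⟨_, h1, h2, ?_, ?_, ?_⟩
  · have h0' : ρ (Iic 0) = 0 := measure_mono_null (fun x hx => lt_of_le_of_lt hx hk) h0
    simp [h0', Measure.dirac_apply' _ measurableSet_Iic, ha0]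
  · rw [h3, hm]; ring
  · intro j hj hj'
    rw [h4]
    rcases eq_or_lt_of_le hj with rfl | hj
    · rw [hk1, call_shift ρ hint _ _ hk.le h0, (hc 2 le_rfl (by omega)).2, hm]
      simp only [sub_zero]
      rw [max_eq_left ha0.le]
      linarith
    · obtain ⟨hA, hB⟩ := hc j hj hj'
      rw [hB, max_eq_right (by linarith)]
      ring

lemma exists_full : ∃ ν : Measure ℝ, IsFiniteMeasure ν ∧ Integrable (fun x => x) ν ∧
    ν (Iic 0) = 0 ∧ ∀ a b : ℝ, 0 < a → a < b → 0 < ν (Ioo a b) := by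
  have hmeas : Measurable (fun x : ℝ => Real.toNNReal (Real.exp (-x))) := by fun_prop
  refine ⟨(volume.restrict (Ioi 0)).withDensity
    (fun x : ℝ => (Real.toNNReal (Real.exp (-x)) : ENNReal)), ?_, ?_, ?_, ?_⟩
  · apply isFiniteMeasure_withDensity_ofReal
    exact (integrableOn_exp_neg_Ioi 0).2
  · rw [integrable_withDensity_iff_integrable_smul hmeas]
    have := Real.GammaIntegral_convergent (s := 2) (by norm_num)
    refine this.congr (Filter.Eventually.of_forall fun x => ?_)
    have h21 : (2 : ℝ) - 1 = 1 := by norm_num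
    show Real.exp (-x) * x ^ ((2 : ℝ) - 1) = ((Real.exp (-x)).toNNReal : ℝ) * x
    rw [h21, Real.rpow_one, Real.coe_toNNReal _ (Real.exp_nonneg _)]
  · apply withDensity_absolutelyContinuous
    have hdisj : Iic (0 : ℝ) ∩ Ioi 0 = ∅ := by ext x; simp
    rw [Measure.restrict_apply measurableSet_Iic, hdisj, measure_empty]
  · intro a b ha hab
    rw [pos_iff_ne_zero, Ne, withDensity_apply_eq_zero hmeas.coe_nnreal_ennreal]
    have : {x : ℝ | (Real.toNNReal (Real.exp (-x)) : ENNReal) ≠ 0} = univ := by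
      ext x; simp [Real.exp_pos]
    rw [this, univ_inter, Measure.restrict_apply measurableSet_Ioo,
      inter_eq_left.mpr (show Ioo a b ⊆ Ioi 0 from fun x hx => ha.trans hx.1)]
    simp [hab]

theorem statement10 (S₀ : ℝ) (hS₀ : 0 < S₀) (d : ℕ) (hd : 3 ≤ d)
    (k C : ℕ → ℝ) (hk1 : k 1 = 0)
    (hkmono : ∀ i, 1 ≤ i → i < d → k i < k (i + 1))
    (hC1 : C 1 = S₀)
    (D : ℕ → ℝ)
    (hD : ∀ i, 2 ≤ i → i ≤ d → D i = (C i - C (i - 1)) / (k i - k (i - 1)))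
    (hCpos : ∀ i, 2 ≤ i → i ≤ d → max (S₀ - k i) 0 < C i)
    (hDmono : ∀ i, 2 ≤ i → i < d → D i < D (i + 1))
    (hD2 : -1 < D 2) (hDd : D d < 0) :
    ∃ μ : Measure ℝ, IsProbabilityMeasure μ ∧
      μ (Iic 0) = 0 ∧
      (∀ a b : ℝ, 0 < a → a < b → 0 < μ (Ioo a b)) ∧
      Integrable (fun x => x) μ ∧
      (∫ x, x ∂μ) = S₀ ∧
      (∀ i, 2 ≤ i → i ≤ d → (∫ x, max (x - k i) 0 ∂μ) = C i) := by
  obtain ⟨ν, hνf, hνi, hν0, hνp⟩ := exists_full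
  set c : ℕ → ℝ := fun i => ∫ x, max (x - k i) 0 ∂ν with hc
  set E : ℕ → ℝ := fun i => (c i - c (i - 1)) / (k i - k (i - 1)) with hE
  have key : ∀ u v p q : ℝ, u < v → ∀ᶠ ε in nhdsWithin (0 : ℝ) (Ioi 0), u - ε * p < v - ε * q := by
    intro u v p q huv
    apply Filter.Eventually.filter_mono nhdsWithin_le_nhds
    refine Filter.Tendsto.eventually_lt (y := u) (z := v) ?_ ?_ huv
    · have : Continuous (fun ε : ℝ => u - ε * p) := by fun_prop
      simpa using this.tendsto 0
    · have : Continuous (fun ε : ℝ => v - ε * q) := by fun_prop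
      simpa using this.tendsto 0
  have hCd : 0 < C d := lt_of_le_of_lt (le_max_right _ _) (hCpos d (by omega) le_rfl)
  have e1 := key 0 (C d) 0 (c d) hCd
  have e2 : ∀ᶠ ε in nhdsWithin (0 : ℝ) (Ioi 0), ∀ i ∈ Finset.Ico 2 d,
      D i - ε * E i < D (i + 1) - ε * E (i + 1) := by
    rw [Filter.eventually_all_finset]
    intro i hi
    rw [Finset.mem_Ico] at hi
    exact key _ _ _ _ (hDmono i hi.1 hi.2)
  have e3 := key (-1) (D 2) (-ν.real univ) (E 2) hD2
  have e4 := key (D d) 0 (E d) 0 hDd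
  have e5 : ∀ᶠ ε in nhdsWithin (0 : ℝ) (Ioi 0), 0 < ε := self_mem_nhdsWithin
  obtain ⟨ε, h1, h2, h3, h4, hε⟩ := (e1.and (e2.and (e3.and (e4.and e5)))).exists
  obtain ⟨ρ, hf, hint, h0, hm, hcall⟩ := discrete_measure (1 - ε * ν.real univ) d hd k
    (fun i => C i - ε * c i) (fun i => D i - ε * E i) hk1 hkmono (by
      intro i hi hi'
      have hk := hkmono i hi hi'
      have hk' : k (i + 1) - k i ≠ 0 := by linarith
      have := hD (i + 1) (by omega) (by omega)
      simp only [hE, this, Nat.add_sub_cancel]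
      field_simp
      ring) (by simpa using h1)
    (fun i hi hi' => h2 i (Finset.mem_Ico.mpr ⟨hi, hi'⟩)) (by linarith) (by simpa using h4)
  have hfe : IsFiniteMeasure (ENNReal.ofReal ε • ν) := Measure.smul_finite _ ENNReal.ofReal_ne_top
  have hie : ∀ f : ℝ → ℝ, Integrable f ν → Integrable f (ENNReal.ofReal ε • ν) :=
    fun f h => h.smul_measure ENNReal.ofReal_ne_top
  have hall : ∀ j, 1 ≤ j → j ≤ d →
      ∫ x, max (x - k j) 0 ∂(ρ + ENNReal.ofReal ε • ν) = C j := by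
    intro j hj hj'
    rw [integral_add_measure (call_integrable ρ hint _) (hie _ (call_integrable ν hνi _)),
      integral_smul_measure, hcall j hj hj', ENNReal.toReal_ofReal hε.le]
    simp [hc]
  have hz : (ρ + ENNReal.ofReal ε • ν) (Iic 0) = 0 := by simp [h0, hν0]
  refine ⟨ρ + ENNReal.ofReal ε • ν, ?_, hz, ?_, hint.add_measure (hie _ hνi), ?_,
    fun i hi hi' => hall i (by omega) hi'⟩
  · have : (ρ + ENNReal.ofReal ε • ν).real univ = 1 := by
      rw [measureReal_add_apply, measureReal_ennreal_smul_apply, hm, ENNReal.toReal_ofReal hε.le]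
      ring
    refine ⟨?_⟩
    rw [Measure.real, ENNReal.toReal_eq_one_iff] at this
    exact this
  · intro a b ha hab
    have := hνp a b ha hab
    have h5 : 0 < ENNReal.ofReal ε * ν (Ioo a b) :=
      ENNReal.mul_pos (by simpa using hε) this.ne'
    simp only [Measure.add_apply, Measure.smul_apply, smul_eq_mul]
    exact lt_of_lt_of_le h5 le_add_self
  · rw [← hC1, ← hall 1 le_rfl (by omega)]
    apply integral_congr_ae
    filter_upwards [measure_eq_zero_iff_ae_notMem.mp hz] with x hx
    simp only [mem_Iic, not_le] at hx
    rw [hk1, sub_zero, max_eq_left hx.le]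
end
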